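/- arXiv:math/0701827 — 4 statements merged into one kernel-verified Lean document; each statement's English description precedes it below -/
import Mathlib

section
/- For all integers n ≥ 1 and m, m' ≥ 1 and every permutation σ ∈ S_n, the convolution of the m-shuffle distribution with the m'-shuffle distribution equals the (m·m')-shuffle distribution: Σ_{τ ∈ S_n} Q_{n,m}(σ·τ⁻¹)·Q_{n,m'}(τ) = Q_{n,m·m'}(σ). -/
open Filter MeasureTheory
open scoped BigOperators NNReal ENNReal

noncomputable section

/-- The value of `σ⁻¹` at position `i` (0-indexed), as a natural number; `0` out of range. -/
def invAt (n : ℕ) (σ : Equiv.Perm (Fin n)) (i : ℕ) : ℕ :=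
  if h : i < n then ((σ⁻¹ ⟨i, h⟩ : Fin n) : ℕ) else 0

/-- The number of rising sequences of a permutation: one plus the number of descents
of its inverse. -/
def rSeq (n : ℕ) (σ : Equiv.Perm (Fin n)) : ℕ :=
  1 + ((Finset.range (n - 1)).filter fun i => invAt n σ (i + 1) < invAt n σ i).card

/-- The `m`-shuffle distribution on `S_n`:  `Q_{n,m}(σ) = m^{-n} C(n + m - r(σ), n)`. -/
def Qs (n m : ℕ) (σ : Equiv.Perm (Fin n)) : ℝ :=
  ((m : ℝ) ^ n)⁻¹ * (Nat.choose (n + m - rSeq n σ) n : ℝ)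

/-- The uniform distribution on `S_n`. -/
def Us (n : ℕ) (_ : Equiv.Perm (Fin n)) : ℝ := (n.factorial : ℝ)⁻¹

/-- Total variation distance between two probability distributions on `S_n`. -/
def tv (n : ℕ) (μ ν : Equiv.Perm (Fin n) → ℝ) : ℝ :=
  (1 / 2) * ∑ σ : Equiv.Perm (Fin n), |μ σ - ν σ|

/-- Convolution of two distributions on `S_n`. -/
def convol (n : ℕ) (μ ν : Equiv.Perm (Fin n) → ℝ) : Equiv.Perm (Fin n) → ℝ :=
  fun σ => ∑ τ : Equiv.Perm (Fin n), μ (σ * τ⁻¹) * ν τ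

/-- `k`-fold convolution power; the `0`-th power is the point mass at the identity. -/
def iterConv (n : ℕ) (μ : Equiv.Perm (Fin n) → ℝ) : ℕ → Equiv.Perm (Fin n) → ℝ
  | 0 => fun σ => if σ = 1 then 1 else 0
  | k + 1 => convol n μ (iterConv n μ k)

/-- `Ψ(x) = (2π)^{-1/2} ∫_{-x/(4√3)}^{x/(4√3)} e^{-t²/2} dt`. -/
def Psi (x : ℝ) : ℝ :=
  (Real.sqrt (2 * Real.pi))⁻¹ *
    ∫ t in (-(x / (4 * Real.sqrt 3)))..(x / (4 * Real.sqrt 3)), Real.exp (-t ^ 2 / 2)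

/-- The `p`-shuffle distribution on `S_n` for a probability `p` on the positive integers. -/
def Qp (n : ℕ) (p : ℕ → ℝ) (σ : Equiv.Perm (Fin n)) : ℝ := ∑' m : ℕ, p m * Qs n m σ

namespace Tuple

lemma sort_orderIso_comp {n : ℕ} {α β : Type*} [LinearOrder α] [LinearOrder β] (e : α ≃o β)
    (f : Fin n → α) : sort (e ∘ f) = sort f := by
  refine (eq_sort_iff.2 ⟨?_, fun i j hij h => ?_⟩).symm
  · exact e.monotone.comp (monotone_sort f)
  · exact (eq_sort_iff.1 (rfl : sort f = sort f)).2 i j hij (e.injective h)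

/-- Sorting by the second key and then stably by the first key sorts lexicographically. -/
lemma sort_toLex {n : ℕ} {α β : Type*} [LinearOrder α] [LinearOrder β]
    (g : Fin n → α) (h : Fin n → β) :
    sort (fun i => toLex (g ((sort h)⁻¹ i), h i)) = sort h * sort g := by
  have hg := eq_sort_iff.1 (rfl : sort g = sort g)
  have hh := eq_sort_iff.1 (rfl : sort h = sort h)
  refine (eq_sort_iff.2 ⟨fun i j hij => ?_, fun i j hij hf => ?_⟩).symm
  · rcases hij.eq_or_lt with rfl | hij
    · exact le_rfl
    simp only [Function.comp_apply, Equiv.Perm.mul_apply, Equiv.Perm.coe_inv,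
      Equiv.symm_apply_apply, Prod.Lex.toLex_le_toLex]
    rcases (hg.1 hij.le).lt_or_eq with hlt | heq
    · exact Or.inl hlt
    · exact Or.inr ⟨heq, hh.1 (hg.2 i j hij heq).le⟩
  · simp only [Equiv.Perm.mul_apply, Equiv.Perm.coe_inv, Equiv.symm_apply_apply,
      EmbeddingLike.apply_eq_iff_eq, Prod.mk.injEq] at hf ⊢
    exact hh.2 _ _ (hg.2 i j hij hf.1) hf.2

lemma eq_sort_iff_succ {n : ℕ} {α : Type*} [LinearOrder α] (f : Fin (n + 1) → α)
    (π : Equiv.Perm (Fin (n + 1))) :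
    π = sort f ↔ ∀ i : Fin n, f (π i.castSucc) ≤ f (π i.succ) ∧
      (π i.succ < π i.castSucc → f (π i.castSucc) < f (π i.succ)) := by
  rw [eq_sort_iff', Fin.strictMono_iff_lt_succ]
  refine forall_congr' fun i => ?_
  have hne : π i.castSucc ≠ π i.succ := π.injective.ne (Fin.castSucc_lt_succ).ne
  change toLex (f (π i.castSucc), π i.castSucc) < toLex (f (π i.succ), π i.succ) ↔ _
  rw [Prod.Lex.toLex_lt_toLex]
  constructor
  · rintro (h | ⟨h, h'⟩)
    · exact ⟨h.le, fun _ => h⟩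
    · exact ⟨h.le, fun h'' => absurd h' h''.asymm⟩
  · rintro ⟨h, h'⟩
    rcases h.lt_or_eq with h | h
    · exact Or.inl h
    · exact Or.inr ⟨h, lt_of_le_of_ne (not_lt.1 fun h'' => (h' h'').ne h) hne⟩

end Tuple

lemma Fin.add_le_of_strictMono {n N : ℕ} {g : Fin n → Fin N} (hg : StrictMono g) {i j : Fin n}
    {d : ℕ} (h : (j : ℕ) = i + d) : (g i : ℕ) + d ≤ g j := by
  induction d generalizing j with
  | zero => rw [Fin.ext h]; simp
  | succ d ih =>
    have h₁ := ih (j := ⟨i + d, by omega⟩) rfl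
    have h₂ : g ⟨i + d, by omega⟩ < g j := hg (Fin.lt_def.2 (by simp; omega))
    rw [Fin.lt_def] at h₂
    omega

/-- Weakly increasing sequences with prescribed strict increases correspond to strictly increasing
sequences, by adding to each entry the number of earlier positions with no prescribed increase. -/
def weakStrictEquiv (k m : ℕ) (P : ℕ → Prop) [DecidablePred P] :
    {f : Fin (k + 1) → Fin m // ∀ i : Fin k, f i.castSucc ≤ f i.succ ∧
      (P i → f i.castSucc < f i.succ)} ≃
    (Fin (k + 1) ↪o Fin (m + Nat.count (fun j => ¬ P j) k)) where
  toFun f := OrderEmbedding.ofStrictMono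
    (fun i => ⟨f.1 i + Nat.count (fun j => ¬ P j) i,
      add_lt_add_of_lt_of_le (f.1 i).2 (Nat.count_monotone _ (Nat.lt_succ_iff.1 i.2))⟩) <| by
    rw [Fin.strictMono_iff_lt_succ]
    intro i
    have h := f.2 i
    simp only [Fin.lt_def, Fin.le_def] at h ⊢
    simp only [Fin.val_castSucc, Fin.val_succ, Nat.count_succ]
    split_ifs with hP
    · have := h.2 hP
      omega
    · omega
  invFun g := ⟨fun i => ⟨g i - Nat.count (fun j => ¬ P j) i, by
      have h₁ := Fin.add_le_of_strictMono g.strictMono (i := i) (j := Fin.last k) (d := k - i)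
        (by simp; omega)
      have h₂ := (g (Fin.last k)).2
      have h₃ := Nat.count_add (fun j => ¬ P j) i (k - i)
      have h₄ := Nat.count_le (p := fun j => ¬ P (i + j)) (n := k - i)
      have h₅ := Fin.add_le_of_strictMono g.strictMono (i := 0) (j := i) (d := i) (by simp)
      have h₆ := Nat.count_le (p := fun j => ¬ P j) (n := i)
      rw [Nat.add_sub_cancel' (by omega)] at h₃
      omega⟩, by
    intro i
    have h := g.strictMono (Fin.castSucc_lt_succ (i := i))
    have h₅ := Fin.add_le_of_strictMono g.strictMono (i := 0) (j := i.castSucc) (d := i) (by simp)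
    have h₆ := Nat.count_le (p := fun j => ¬ P j) (n := i)
    simp only [Fin.lt_def, Fin.le_def] at h ⊢
    simp only [Fin.val_castSucc, Fin.val_succ, Nat.count_succ]
    split_ifs with hP
    · omega
    · exact ⟨by omega, fun h => absurd h hP⟩⟩
  left_inv f := by ext i; simp
  right_inv g := by
    ext i
    have h₅ := Fin.add_le_of_strictMono g.strictMono (i := 0) (j := i) (d := i) (by simp)
    have h₆ := Nat.count_le (p := fun j => ¬ P j) (n := i)
    simp
    omega

lemma invAt_of_lt {n : ℕ} (σ : Equiv.Perm (Fin n)) {i : ℕ} (h : i < n) :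
    invAt n σ i = (σ⁻¹ ⟨i, h⟩ : Fin n) :=
  dif_pos h

/-- The number of `m`-shuffles producing `σ`, each encoded by the pile of every card. -/
lemma card_sort_eq_inv {n : ℕ} (hn : 1 ≤ n) (m : ℕ) (σ : Equiv.Perm (Fin n)) :
    (Finset.univ.filter fun f : Fin n → Fin m => Tuple.sort f = σ⁻¹).card =
      (n + m - rSeq n σ).choose n := by
  obtain ⟨k, rfl⟩ : ∃ k, n = k + 1 := ⟨n - 1, by omega⟩
  set P : ℕ → Prop := fun i => invAt (k + 1) σ (i + 1) < invAt (k + 1) σ i with hP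
  have hN : k + 1 + m - rSeq (k + 1) σ = m + Nat.count (fun j => ¬ P j) k := by
    have h₁ : rSeq (k + 1) σ = 1 + Nat.count P k := by
      rw [Nat.count_eq_card_filter_range]
      rfl
    have h₂ : Nat.count P k + Nat.count (fun j => ¬ P j) k = k := by
      simp only [Nat.count_eq_card_filter_range]
      rw [Finset.card_filter_add_card_filter_not, Finset.card_range]
    omega
  have e : {f : Fin (k + 1) → Fin m // Tuple.sort f = σ⁻¹} ≃
      (Fin (k + 1) ↪o Fin (m + Nat.count (fun j => ¬ P j) k)) := by
    refine Equiv.trans (Equiv.subtypeEquiv (Equiv.arrowCongr σ (Equiv.refl _)) fun f => ?_)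
      (weakStrictEquiv k m P)
    rw [eq_comm, Tuple.eq_sort_iff_succ]
    refine forall_congr' fun i => ?_
    have h : P i ↔ σ⁻¹ i.succ < σ⁻¹ i.castSucc := by
      simp only [hP]
      rw [invAt_of_lt σ (by omega), invAt_of_lt σ (by omega)]
      rfl
    rw [h]
    rfl
  rw [hN, ← Fintype.card_subtype, ← Nat.card_eq_fintype_card,
    Nat.card_congr (e.trans Set.powersetCard.ofFinEmbEquiv), Set.powersetCard.card, Nat.card_fin]

lemma sum_card_sort_mul_card_sort {n m m' : ℕ} (σ : Equiv.Perm (Fin n)) :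
    ∑ τ : Equiv.Perm (Fin n),
      (Finset.univ.filter fun g : Fin n → Fin m => Tuple.sort g = (σ * τ⁻¹)⁻¹).card *
      (Finset.univ.filter fun h : Fin n → Fin m' => Tuple.sort h = τ⁻¹).card =
    (Finset.univ.filter fun f : Fin n → Fin (m * m') => Tuple.sort f = σ⁻¹).card := by
  let e : Fin m ×ₗ Fin m' ≃o Fin (m * m') :=
    (Fintype.orderIsoFinOfCardEq _ (by simp [Fintype.card_lex])).symm
  let F : (Fin n → Fin m) × (Fin n → Fin m') → Fin n → Fin (m * m') :=
    fun p => e ∘ fun i => toLex (p.1 ((Tuple.sort p.2)⁻¹ i), p.2 i)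
  have hsort (p) : Tuple.sort (F p) = Tuple.sort p.2 * Tuple.sort p.1 := by
    rw [Tuple.sort_orderIso_comp, Tuple.sort_toLex]
  have hF : Function.Bijective F := by
    constructor
    · rintro ⟨g, h⟩ ⟨g', h'⟩ heq
      have h₁ (i) : (g ((Tuple.sort h)⁻¹ i), h i) = (g' ((Tuple.sort h')⁻¹ i), h' i) :=
        toLex.injective (e.injective (congrFun heq i))
      obtain rfl : h = h' := funext fun i => congrArg Prod.snd (h₁ i)
      refine Prod.ext (funext fun i => ?_) rfl
      simpa using congrArg Prod.fst (h₁ (Tuple.sort h i))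
    · intro f
      refine ⟨(fun i => (ofLex (e.symm (f (Tuple.sort (fun i => (ofLex (e.symm (f i))).2) i)))).1,
        fun i => (ofLex (e.symm (f i))).2), ?_⟩
      ext i
      simp [F]
  calc _ = (Finset.univ.filter fun p : (Fin n → Fin m) × (Fin n → Fin m') =>
        Tuple.sort p.2 * Tuple.sort p.1 = σ⁻¹).card := by
        rw [Finset.card_eq_sum_card_fiberwise (f := fun p => (Tuple.sort p.2)⁻¹)
          (t := Finset.univ) (by simp)]
        refine Finset.sum_congr rfl fun τ _ => ?_
        rw [← Finset.card_product]
        congr 1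
        ext ⟨g, h⟩
        simp only [Finset.mem_product, Finset.mem_filter, Finset.mem_univ, true_and, mul_inv_rev,
          inv_inv, inv_eq_iff_eq_inv]
        refine and_congr_left fun hh => ?_
        rw [hh, inv_mul_eq_iff_eq_mul]
    _ = _ := Finset.card_bijective F hF (by simp [hsort])

/-- An `m`-shuffle followed by an `m'`-shuffle is an `(m·m')`-shuffle. -/
theorem shuffle_convolution (n m m' : ℕ) (hn : 1 ≤ n) (hm : 1 ≤ m) (hm' : 1 ≤ m')
    (σ : Equiv.Perm (Fin n)) :
    ∑ τ : Equiv.Perm (Fin n), Qs n m (σ * τ⁻¹) * Qs n m' τ = Qs n (m * m') σ := by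
  simp only [Qs, ← card_sort_eq_inv hn, ← sum_card_sort_mul_card_sort (m := m) (m' := m')]
  push_cast
  rw [Finset.mul_sum]
  refine Finset.sum_congr rfl fun τ _ => ?_
  rw [mul_pow, mul_inv]
  ring
end
end

section
/- For every a > 0 there exist a constant C > 0 and N ∈ ℕ such that for all integers n ≥ N and m ≥ 1 with c := m·n^{−3/2} > a, one has |‖Q_{n,m} − U_n‖_TV − Ψ(1/c)| ≤ C·n^{−1/4}. -/
open Filter MeasureTheory
open scoped BigOperators NNReal ENNReal

noncomputable section

/-- The number of descents of a finite sequence. -/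
def desc {α : Type*} [LinearOrder α] {n : ℕ} (u : Fin (n + 1) → α) : ℕ :=
  ∑ i : Fin n, if u i.succ < u i.castSucc then 1 else 0

theorem desc_le {α : Type*} [LinearOrder α] {n : ℕ} (u : Fin (n + 1) → α) : desc u ≤ n := by
  calc desc u ≤ ∑ _i : Fin n, 1 := Finset.sum_le_sum fun i _ => by split_ifs <;> simp
    _ = n := by simp

theorem desc_snoc {α : Type*} [LinearOrder α] {n : ℕ} (u : Fin (n + 1) → α) (x : α) :
    desc (Fin.snoc u x : Fin (n + 2) → α) = desc u + if x < u (Fin.last n) then 1 else 0 := by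
  unfold desc
  rw [Fin.sum_univ_castSucc]
  congr 1
  · refine Finset.sum_congr rfl fun i _ => ?_
    rw [← Fin.castSucc_succ, Fin.snoc_castSucc, Fin.snoc_castSucc]
  · rw [Fin.succ_last, Fin.snoc_last, Fin.snoc_castSucc]

theorem desc_comp_strictMono {α β : Type*} [LinearOrder α] [LinearOrder β] {n : ℕ}
    {g : α → β} (hg : StrictMono g) (u : Fin (n + 1) → α) : desc (g ∘ u) = desc u := by
  simp [desc, hg.lt_iff_lt]

theorem rSeq_eq_desc {n : ℕ} (σ : Equiv.Perm (Fin (n + 1))) :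
    rSeq (n + 1) σ = 1 + desc (σ⁻¹ : Equiv.Perm (Fin (n + 1))) := by
  unfold rSeq desc
  rw [Finset.card_filter, Nat.add_sub_cancel, Finset.sum_range]
  congr 1
  refine Finset.sum_congr rfl fun i _ => ?_
  have h1 : invAt (n + 1) σ (i + 1) = (σ⁻¹ i.succ : Fin (n + 1)) := by
    rw [invAt, dif_pos (by omega)]; rfl
  have h2 : invAt (n + 1) σ i = (σ⁻¹ i.castSucc : Fin (n + 1)) := by
    rw [invAt, dif_pos (by omega)]; rfl
  rw [h1, h2]
  simp only [Fin.val_fin_lt]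

/-- A sequence that is weakly increasing, and strictly increasing at the positions where
`u` has a descent. -/
def Compat {α : Type*} [LinearOrder α] {n m : ℕ} (u : Fin (n + 1) → α) (y : Fin (n + 1) → Fin m) :
    Prop :=
  ∀ i : Fin n, y i.castSucc ≤ y i.succ ∧ (u i.succ < u i.castSucc → y i.castSucc < y i.succ)

theorem compat_snoc {α : Type*} [LinearOrder α] {n m : ℕ} (u : Fin (n + 1) → α) (x : α)
    (y : Fin (n + 1) → Fin m) (j : Fin m) :
    Compat (Fin.snoc u x : Fin (n + 2) → α) (Fin.snoc y j : Fin (n + 2) → Fin m) ↔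
      Compat u y ∧ (y (Fin.last n) : ℕ) < j + if x < u (Fin.last n) then 0 else 1 := by
  unfold Compat
  rw [Fin.forall_fin_succ']
  refine and_congr (forall_congr' fun i => ?_) ?_
  · simp only [← Fin.castSucc_succ, Fin.snoc_castSucc]
  · simp only [Fin.succ_last, Fin.snoc_last, Fin.snoc_castSucc, Fin.le_def, Fin.lt_def]
    split_ifs with h
    · simp only [h, true_imp_iff]; omega
    · simp only [h, false_imp_iff, and_true]; omega

open Classical in
theorem card_compat_last_lt {α : Type*} [LinearOrder α] {n m : ℕ} (u : Fin (n + 1) → α) (k : ℕ)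
    (hk : k ≤ m) :
    (∑ y : Fin (n + 1) → Fin m, if Compat u y ∧ (y (Fin.last n) : ℕ) < k then 1 else 0) =
      (k + n - desc u).choose (n + 1) := by
  induction n generalizing k with
  | zero =>
    have hc : ∀ y : Fin 1 → Fin m, Compat u y := fun y i => i.elim0
    have hd : desc u = 0 := by simp [desc]
    simp only [hc, true_and, hd, zero_add, Nat.choose_one_right]
    rw [← (Equiv.funUnique (Fin 1) (Fin m)).symm.sum_comp]
    simp [Fin.sum_univ_eq_sum_range (fun i => if i < k then 1 else 0) m]
    rw [← Finset.card_range k]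
    congr 1
    ext i; simp; omega
  | succ n ih =>
    obtain ⟨u, x, rfl⟩ : ∃ (v : Fin (n + 1) → α) (x : α), u = Fin.snoc v x :=
      ⟨Fin.init u, u (Fin.last _), (Fin.snoc_init_self u).symm⟩
    rw [← (Fin.snocEquiv fun _ : Fin (n + 2) => Fin m).sum_comp, Fintype.sum_prod_type]
    have hd := desc_le u
    have key : ∀ j : Fin m, (∑ y : Fin (n + 1) → Fin m,
        if Compat (Fin.snoc u x : Fin (n + 2) → α)
            ((Fin.snocEquiv fun _ : Fin (n + 2) => Fin m) (j, y)) ∧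
          (((Fin.snocEquiv fun _ : Fin (n + 2) => Fin m) (j, y) (Fin.last _) : Fin m) : ℕ) < k
          then 1 else 0) =
        if (j : ℕ) < k then ((j + if x < u (Fin.last n) then 0 else 1) + n - desc u).choose (n + 1)
          else 0 := by
      intro j
      have : ∀ y : Fin (n + 1) → Fin m, (Fin.snocEquiv fun _ : Fin (n + 2) => Fin m) (j, y) =
        (Fin.snoc y j : Fin (n + 2) → Fin m) := fun _ => rfl
      simp only [this, Fin.snoc_last, compat_snoc]
      by_cases hj : (j : ℕ) < k
      · simp only [hj, and_true, if_true]
        split_ifs with hx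
        · exact ih u _ (by omega)
        · exact ih u _ (by omega)
      · simp [hj]
    rw [Finset.sum_congr rfl fun j _ => key j, desc_snoc,
      Fin.sum_univ_eq_sum_range (fun j => if j < k then
        ((j + if x < u (Fin.last n) then 0 else 1) + n - desc u).choose (n + 1) else 0) m,
      ← Finset.sum_filter]
    have hr : (Finset.range m).filter (· < k) = Finset.range k := by
      ext i; simp; omega
    rw [hr]
    clear hr key ih hk
    generalize desc u = d at *
    induction k with
    | zero =>
      symm; rw [Finset.sum_range_zero]; apply Nat.choose_eq_zero_of_lt
      omega
    | succ k ihk =>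
      rw [Finset.sum_range_succ, ihk]
      split_ifs
      · rw [show k + 1 + (n + 1) - (d + 1) = (k + n - d) + 1 by omega, Nat.choose_succ_succ,
          show k + (n + 1) - (d + 1) = k + n - d by omega, add_zero, add_comm]
      · rw [show k + 1 + (n + 1) - (d + 0) = (k + n + 1 - d) + 1 by omega, Nat.choose_succ_succ,
          show k + (n + 1) - (d + 0) = k + n + 1 - d by omega,
          show k + 1 + n - d = k + n + 1 - d by omega, add_comm]

theorem compat_iff_sort {n m : ℕ} (π : Equiv.Perm (Fin (n + 1))) (w : Fin (n + 1) → Fin m) :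
    Compat π (w ∘ π) ↔ Tuple.sort w = π := by
  rw [eq_comm, Tuple.eq_sort_iff]
  constructor
  · intro h
    have hm : Monotone (w ∘ π) := Fin.monotone_iff_le_succ.2 fun i => (h i).1
    refine ⟨hm, fun i j hij hw => ?_⟩
    have hs : StrictMono fun i => toLex (w (π i), π i) := by
      refine Fin.strictMono_iff_lt_succ.2 fun i => Prod.Lex.toLex_lt_toLex.2 ?_
      rcases (h i).1.lt_or_eq with h' | h'
      · exact Or.inl h'
      · refine Or.inr ⟨h', lt_of_le_of_ne (not_lt.1 fun hd => ((h i).2 hd).ne h') ?_⟩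
        exact π.injective.ne (Fin.castSucc_lt_succ).ne
    rcases Prod.Lex.toLex_lt_toLex.1 (hs hij) with h' | h'
    · exact absurd hw h'.ne
    · exact h'.2
  · rintro ⟨hm, hs⟩ i
    refine ⟨hm (Fin.castSucc_le_succ i), fun hd => lt_of_le_of_ne (hm (Fin.castSucc_le_succ i)) ?_⟩
    intro he
    exact absurd (hs _ _ (Fin.castSucc_lt_succ) he) hd.not_gt

/-- Worpitzky's identity. -/
theorem sum_choose_desc (n m : ℕ) :
    ∑ π : Equiv.Perm (Fin (n + 1)), (m + n - desc π).choose (n + 1) = m ^ (n + 1) := by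
  classical
  have h : ∀ π : Equiv.Perm (Fin (n + 1)), (m + n - desc π).choose (n + 1) =
      ∑ w : Fin (n + 1) → Fin m, if Tuple.sort w = π then 1 else 0 := by
    intro π
    rw [← card_compat_last_lt π m le_rfl, ← (Equiv.arrowCongr π (Equiv.refl (Fin m))).symm.sum_comp]
    refine Finset.sum_congr rfl fun w _ => ?_
    have : (Equiv.arrowCongr π (Equiv.refl (Fin m))).symm w = w ∘ π := by ext i; simp
    rw [this]
    simp [compat_iff_sort]
  rw [Finset.sum_congr rfl fun π _ => h π, Finset.sum_comm]
  simp

theorem sum_Qs (n m : ℕ) (hm : 1 ≤ m) :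
    ∑ σ : Equiv.Perm (Fin (n + 1)), Qs (n + 1) m σ = 1 := by
  unfold Qs
  rw [← Finset.mul_sum, ← Equiv.sum_comp (Equiv.inv (Equiv.Perm (Fin (n + 1))))]
  have := sum_choose_desc n m
  have h2 : ∀ σ : Equiv.Perm (Fin (n + 1)),
      n + 1 + m - rSeq (n + 1) ((Equiv.inv (Equiv.Perm (Fin (n + 1)))) σ) = m + n - desc σ := by
    intro σ
    rw [rSeq_eq_desc, Equiv.inv_apply, inv_inv]; omega
  simp only [h2]
  rw [← Nat.cast_sum, this]
  have : (m : ℝ) ≠ 0 := by positivity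
  push_cast
  field_simp

/-- The averaging operator of a uniform random variable on `[0, 1]`. -/
def unifAvg (Φ : ℝ → ℝ) (s : ℝ) : ℝ := ∫ v in (0 : ℝ)..1, Φ (s + v)

theorem continuous_unifAvg {Φ : ℝ → ℝ} (hΦ : Continuous Φ) : Continuous (unifAvg Φ) := by
  unfold unifAvg
  exact intervalIntegral.continuous_parametric_intervalIntegral_of_continuous' (by fun_prop) 0 1

theorem abs_unifAvg_le {Φ : ℝ → ℝ} {B : ℝ} (hB : ∀ x, |Φ x| ≤ B) (s : ℝ) : |unifAvg Φ s| ≤ B := by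
  have := intervalIntegral.norm_integral_le_of_norm_le_const (a := (0 : ℝ)) (b := 1)
    (f := fun v => Φ (s + v)) (C := B) fun v _ => hB _
  simpa [unifAvg] using this

/-- The uniform distribution on `[0, 1]`. -/
def unif : Measure ℝ := volume.restrict (Set.Ioc 0 1)

instance : IsProbabilityMeasure unif := ⟨by simp [unif]⟩

/-- The uniform distribution on `[0, 1]ⁿ`. -/
def cube (n : ℕ) : Measure (Fin n → ℝ) := Measure.pi fun _ => unif

instance (n : ℕ) : IsProbabilityMeasure (cube n) := by unfold cube; infer_instance

theorem integral_unif (Φ : ℝ → ℝ) : ∫ x, Φ x ∂unif = ∫ x in (0 : ℝ)..1, Φ x := by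
  rw [intervalIntegral.integral_of_le zero_le_one, unif]

theorem measurable_desc (n : ℕ) : Measurable fun u : Fin (n + 1) → ℝ => desc u := by
  unfold desc
  refine Finset.measurable_sum _ fun i _ => ?_
  exact Measurable.ite (measurableSet_lt (measurable_pi_apply _) (measurable_pi_apply _))
    measurable_const measurable_const

theorem integral_wrap {Φ : ℝ → ℝ} (hΦ : Continuous Φ) {x : ℝ} (hx0 : 0 ≤ x) (hx1 : x ≤ 1) (d : ℕ) :
    ∫ v in (0 : ℝ)..1, Φ ((d + if v < x then 1 else 0 : ℕ) + v) = unifAvg Φ (d + x) := by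
  have hi : ∀ a b : ℝ, IntervalIntegrable Φ volume a b := fun a b => hΦ.intervalIntegrable a b
  have e1 : ∫ v in (0 : ℝ)..x, Φ ((d + if v < x then 1 else 0 : ℕ) + v) =
      ∫ v in (d + 1 : ℝ)..(d + 1 + x), Φ v := by
    rw [show (∫ v in (d + 1 : ℝ)..(d + 1 + x), Φ v) = ∫ v in (0 : ℝ)..x, Φ (d + 1 + v) by
      rw [intervalIntegral.integral_comp_add_left, add_zero]]
    refine intervalIntegral.integral_congr_ae ?_
    have : ∀ᵐ v : ℝ, v ≠ x := by simp [ae_iff]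
    filter_upwards [this] with v hv hm
    rw [Set.uIoc_of_le hx0] at hm
    rw [if_pos (lt_of_le_of_ne hm.2 hv)]; push_cast; rfl
  have e2 : ∫ v in x..1, Φ ((d + if v < x then 1 else 0 : ℕ) + v) =
      ∫ v in (d + x : ℝ)..(d + 1), Φ v := by
    rw [show (∫ v in (d + x : ℝ)..(d + 1), Φ v) = ∫ v in x..1, Φ (d + v) by
      rw [intervalIntegral.integral_comp_add_left]]
    refine intervalIntegral.integral_congr fun v hv => ?_
    rw [Set.uIcc_of_le hx1] at hv
    rw [if_neg (not_lt.2 hv.1)]; simp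
  have hint : ∀ a b : ℝ, IntervalIntegrable
      (fun v => Φ ((d + if v < x then 1 else 0 : ℕ) + v)) volume a b := by
    intro a b
    have : (fun v => Φ ((d + if v < x then 1 else 0 : ℕ) + v)) =
        fun v => (Set.Iio x).piecewise (fun v => Φ (d + 1 + v)) (fun v => Φ (d + v)) v := by
      ext v; by_cases h : v < x <;> simp [Set.piecewise, h]
    rw [this]
    have c1 : Continuous fun v => Φ (d + 1 + v) := by fun_prop
    have c2 : Continuous fun v => Φ (d + v) := by fun_prop
    rw [intervalIntegrable_iff]
    exact Integrable.piecewise measurableSet_Iio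
      (c1.intervalIntegrable a b).def'.integrableOn (c2.intervalIntegrable a b).def'.integrableOn
  rw [← intervalIntegral.integral_add_adjacent_intervals (hint 0 x) (hint x 1), e1, e2, add_comm,
    intervalIntegral.integral_add_adjacent_intervals (hi _ _) (hi _ _), unifAvg,
    intervalIntegral.integral_comp_add_left, add_zero]
  congr 1; ring

/-- Stanley's description of descents: the sum of the number of descents and the last coordinate
of a uniform point of the cube is distributed as a sum of independent uniform variables. -/
theorem integral_desc_add_last (n : ℕ) {Φ : ℝ → ℝ} (hΦ : Continuous Φ) {B : ℝ}
    (hB : ∀ x, |Φ x| ≤ B) :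
    ∫ u, Φ (desc u + u (Fin.last n)) ∂cube (n + 1) = unifAvg^[n + 1] Φ 0 := by
  induction n generalizing Φ with
  | zero =>
    have h := (measurePreserving_funUnique unif (Fin 1)).symm
    refine (h.integral_comp' (g := fun u : Fin 1 → ℝ =>
      Φ ((desc u : ℕ) + u (Fin.last 0)))).symm.trans ?_
    simp [desc, unifAvg, integral_unif]
  | succ n ih =>
    rw [Function.iterate_succ_apply, ← ih (continuous_unifAvg hΦ) (abs_unifAvg_le hB)]
    have h := (measurePreserving_piFinSuccAbove (fun _ : Fin (n + 2) => unif) (Fin.last _)).symm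
    have hsn : ∀ p : ℝ × (Fin (n + 1) → ℝ),
        (MeasurableEquiv.piFinSuccAbove (fun _ : Fin (n + 2) => ℝ) (Fin.last _)).symm p =
          (Fin.snoc p.2 p.1 : Fin (n + 2) → ℝ) := fun p => Fin.insertNth_last' p.1 p.2
    have hmeas : Measurable fun u : Fin (n + 2) → ℝ => Φ (desc u + u (Fin.last (n + 1))) := by
      have := measurable_desc (n + 1)
      have h2 : Measurable fun u : Fin (n + 2) → ℝ => ((desc u : ℕ) : ℝ) :=
        measurable_from_top.comp this
      exact hΦ.measurable.comp (h2.add (measurable_pi_apply _))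
    rw [cube, ← h.integral_comp', integral_prod_symm]
    · change _ = ∫ u, _ ∂(Measure.pi fun _ => unif)
      refine integral_congr_ae ?_
      have hlast : ∀ᵐ u ∂(Measure.pi fun _ : Fin (n + 1) => unif),
          u (Fin.last n) ∈ Set.Ioc (0 : ℝ) 1 := by
        refine (Measure.quasiMeasurePreserving_eval (fun _ : Fin (n + 1) => unif) (Fin.last n)).ae ?_
        exact ae_restrict_mem measurableSet_Ioc
      filter_upwards [hlast] with u hu
      rw [← integral_wrap hΦ hu.1.le hu.2, ← integral_unif]
      refine integral_congr_ae (Eventually.of_forall fun x => ?_)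
      simp only
      rw [hsn, desc_snoc, Fin.snoc_last]
    · refine Integrable.of_bound (C := B)
        ((hmeas.comp (MeasurableEquiv.measurable _)).aestronglyMeasurable) ?_
      exact Eventually.of_forall fun p => hB _

theorem ae_injective_cube (n : ℕ) : ∀ᵐ u ∂cube n, Function.Injective u := by
  have hac : cube n ≪ (volume : Measure (Fin n → ℝ)) := by
    have : cube n = (volume : Measure (Fin n → ℝ)).restrict
        (Set.pi Set.univ fun _ => Set.Ioc (0 : ℝ) 1) := by
      rw [volume_pi, Measure.restrict_pi_pi]; rfl
    rw [this]
    exact Measure.restrict_le_self.absolutelyContinuous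
  refine hac.ae_le ?_
  have h : ∀ i j : Fin n, i ≠ j → ∀ᵐ u : Fin n → ℝ, u i ≠ u j := by
    intro i j hij
    let S : Submodule ℝ (Fin n → ℝ) :=
      LinearMap.ker (LinearMap.proj (R := ℝ) (φ := fun _ : Fin n => ℝ) i - LinearMap.proj j)
    have hS : S ≠ ⊤ := by
      intro hS
      have : Pi.single i (1 : ℝ) ∈ S := hS ▸ Submodule.mem_top
      simp [S, hij] at this
    have h0 := Measure.addHaar_submodule (volume : Measure (Fin n → ℝ)) S hS
    rw [ae_iff]
    convert h0 using 2
    ext u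
    simp [S, sub_eq_zero]
  have h' : ∀ᵐ u : Fin n → ℝ, ∀ i j : Fin n, i ≠ j → u i ≠ u j := by
    simp only [ae_all_iff]
    exact h
  filter_upwards [h'] with u hu i j
  contrapose
  exact hu i j

theorem sum_desc_comp {n : ℕ} (g : ℕ → ℝ) {u : Fin (n + 1) → ℝ} (hu : Function.Injective u) :
    ∑ τ : Equiv.Perm (Fin (n + 1)), g (desc (u ∘ τ)) =
      ∑ τ : Equiv.Perm (Fin (n + 1)), g (desc τ) := by
  have hs : StrictMono (u ∘ Tuple.sort u) :=
    (Tuple.monotone_sort u).strictMono_of_injective (hu.comp (Tuple.sort u).injective)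
  rw [← Equiv.sum_comp (Equiv.mulLeft (Tuple.sort u))]
  refine Finset.sum_congr rfl fun τ _ => ?_
  rw [← desc_comp_strictMono hs τ]
  rfl

theorem integral_desc_eq_average (n : ℕ) (g : ℕ → ℝ) :
    ∫ u, g (desc u) ∂cube (n + 1) =
      ((n + 1).factorial : ℝ)⁻¹ * ∑ π : Equiv.Perm (Fin (n + 1)), g (desc π) := by
  have hint : ∀ τ : Equiv.Perm (Fin (n + 1)),
      Integrable (fun u : Fin (n + 1) → ℝ => g (desc (u ∘ τ))) (cube (n + 1)) := by
    intro τ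
    refine Integrable.of_bound (C := ∑ d ∈ Finset.range (n + 1), |g d|) ?_ ?_
    · refine Measurable.aestronglyMeasurable ?_
      refine (measurable_from_top (f := g)).comp ((measurable_desc n).comp ?_)
      exact measurable_pi_lambda _ fun i => measurable_pi_apply _
    · refine Eventually.of_forall fun u => ?_
      exact Finset.single_le_sum (f := fun d => |g d|) (fun _ _ => abs_nonneg _)
        (Finset.mem_range.2 (Nat.lt_succ_of_le (desc_le (u ∘ τ))))
  have heq : ∀ τ : Equiv.Perm (Fin (n + 1)),
      ∫ u, g (desc (u ∘ τ)) ∂cube (n + 1) = ∫ u, g (desc u) ∂cube (n + 1) := by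
    intro τ
    have h := measurePreserving_piCongrLeft (fun _ : Fin (n + 1) => unif) τ
    have h2 := h.symm.integral_comp' (g := fun u => g (desc u))
    exact h2
  have hsum : ∑ τ : Equiv.Perm (Fin (n + 1)), ∫ u, g (desc (u ∘ τ)) ∂cube (n + 1) =
      ∑ τ : Equiv.Perm (Fin (n + 1)), g (desc τ) := by
    rw [← integral_finsetSum _ fun τ _ => hint τ]
    rw [integral_congr_ae (g := fun _ => ∑ τ : Equiv.Perm (Fin (n + 1)), g (desc τ))]
    · simp
    · filter_upwards [ae_injective_cube (n + 1)] with u hu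
      exact sum_desc_comp g hu
  rw [← hsum, Finset.sum_congr rfl fun τ _ => heq τ, Finset.sum_const, Finset.card_univ,
    Fintype.card_perm, Fintype.card_fin, nsmul_eq_mul]
  field_simp

theorem average_desc_sub_unifAvg_le (n : ℕ) {Φ : ℝ → ℝ} {L B : ℝ}
    (hL : ∀ x y, |Φ x - Φ y| ≤ L * |x - y|) (hΦ : Continuous Φ) (hB : ∀ x, |Φ x| ≤ B) :
    |((n + 1).factorial : ℝ)⁻¹ * ∑ π : Equiv.Perm (Fin (n + 1)), Φ (desc π + 1 / 2) -
      unifAvg^[n + 1] Φ 0| ≤ L := by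
  have hL0 : 0 ≤ L := by simpa using (abs_nonneg _).trans (hL 1 0)
  have hm : Measurable fun u : Fin (n + 1) → ℝ => ((desc u : ℕ) : ℝ) :=
    measurable_from_top.comp (measurable_desc n)
  rw [← integral_desc_eq_average n fun d => Φ (d + 1 / 2), ← integral_desc_add_last n hΦ hB,
    ← integral_sub]
  · have hlast : ∀ᵐ u ∂cube (n + 1), u (Fin.last n) ∈ Set.Ioc (0 : ℝ) 1 := by
      refine (Measure.quasiMeasurePreserving_eval (fun _ : Fin (n + 1) => unif) (Fin.last n)).ae ?_
      exact ae_restrict_mem measurableSet_Ioc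
    have := norm_integral_le_of_norm_le_const (μ := cube (n + 1)) (C := L)
      (f := fun u => Φ (desc u + 1 / 2) - Φ (desc u + u (Fin.last n))) ?_
    · simpa using this
    · filter_upwards [hlast] with u hu
      refine (hL _ _).trans ?_
      have : |(desc u : ℝ) + 1 / 2 - (desc u + u (Fin.last n))| ≤ 1 := by
        rw [abs_le]; constructor <;> linarith [hu.1, hu.2]
      nlinarith
  · exact Integrable.of_bound (C := B)
      (hΦ.measurable.comp (hm.add_const _)).aestronglyMeasurable
      (Eventually.of_forall fun u => hB _)
  · exact Integrable.of_bound (C := B)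
      (hΦ.measurable.comp (hm.add (measurable_pi_apply _))).aestronglyMeasurable
      (Eventually.of_forall fun u => hB _)

section Gaussian

open ProbabilityTheory

/-- The averaging operator of a centred Gaussian random variable with variance `t`. -/
def gaussAvg (t : ℝ≥0) (f : ℝ → ℝ) (x : ℝ) : ℝ := ∫ y, f (x + y) ∂gaussianReal 0 t

theorem integrable_gaussian_comp_add (t : ℝ≥0) {f : ℝ → ℝ} (hf : Continuous f) {B : ℝ}
    (hB : ∀ x, |f x| ≤ B) (x : ℝ) : Integrable (fun y => f (x + y)) (gaussianReal 0 t) :=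
  Integrable.of_bound (C := B) (by fun_prop) (Eventually.of_forall fun _ => hB _)

theorem abs_gaussAvg_le (t : ℝ≥0) {f : ℝ → ℝ} {B : ℝ} (hB : ∀ x, |f x| ≤ B) (x : ℝ) :
    |gaussAvg t f x| ≤ B := by
  have := norm_integral_le_of_norm_le_const (μ := gaussianReal 0 t) (C := B)
    (f := fun y => f (x + y)) (Eventually.of_forall fun _ => hB _)
  simpa [gaussAvg] using this

theorem abs_gaussAvg_sub_le (t : ℝ≥0) {f : ℝ → ℝ} (hf : Continuous f) {B L : ℝ}
    (hB : ∀ x, |f x| ≤ B) (hL : ∀ x y, |f x - f y| ≤ L * |x - y|) (x y : ℝ) :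
    |gaussAvg t f x - gaussAvg t f y| ≤ L * |x - y| := by
  rw [gaussAvg, gaussAvg, ← integral_sub (integrable_gaussian_comp_add t hf hB x)
    (integrable_gaussian_comp_add t hf hB y)]
  have := norm_integral_le_of_norm_le_const (μ := gaussianReal 0 t) (C := L * |x - y|)
    (f := fun z => f (x + z) - f (y + z)) (Eventually.of_forall fun z => by
      refine (hL _ _).trans_eq ?_; ring_nf)
  simpa using this

theorem continuous_of_abs_sub_le {f : ℝ → ℝ} {L : ℝ} (hL : ∀ x y, |f x - f y| ≤ L * |x - y|) :
    Continuous f := by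
  have hL0 : 0 ≤ L := by simpa using (abs_nonneg _).trans (hL 1 0)
  exact (LipschitzWith.of_dist_le_mul (K := ⟨L, hL0⟩) fun x y => hL x y).continuous

theorem gaussAvg_gaussAvg (s t : ℝ≥0) {f : ℝ → ℝ} (hf : Continuous f) {B : ℝ}
    (hB : ∀ x, |f x| ≤ B) (x : ℝ) :
    gaussAvg s (gaussAvg t f) x = gaussAvg (s + t) f x := by
  unfold gaussAvg
  have h := gaussianReal_conv_gaussianReal (m₁ := 0) (m₂ := 0) (v₁ := s) (v₂ := t)
  rw [add_zero] at h
  rw [← h, Measure.conv, integral_map (by fun_prop) (by fun_prop), integral_prod]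
  · simp [add_assoc]
  · exact Integrable.of_bound (C := B) (by fun_prop) (Eventually.of_forall fun _ => hB _)

/-- The Cameron-Martin formula in dimension one. -/
theorem integral_gaussian_comp_add {t : ℝ≥0} (ht : t ≠ 0) (G : ℝ → ℝ) (x : ℝ) :
    ∫ y, G (x + y) ∂gaussianReal 0 t =
      ∫ y, G y * Real.exp (x / t * y - x ^ 2 / (2 * t)) ∂gaussianReal 0 t := by
  have ht' : (t : ℝ) ≠ 0 := by exact_mod_cast ht
  rw [integral_gaussianReal_eq_integral_smul ht, integral_gaussianReal_eq_integral_smul ht,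
    ← integral_add_left_eq_self (fun y => gaussianPDFReal 0 t y • (G y *
      Real.exp (x / t * y - x ^ 2 / (2 * t)))) x]
  refine integral_congr_ae (Eventually.of_forall fun y => ?_)
  simp only [gaussianPDFReal, smul_eq_mul]
  rw [show Real.exp (-(y - 0) ^ 2 / (2 * t)) = Real.exp (-(x + y - 0) ^ 2 / (2 * t)) *
    Real.exp (x / t * (x + y) - x ^ 2 / (2 * t)) by
      rw [← Real.exp_add]; congr 1; field_simp; ring]
  ring

/-- First derivative of `gaussAvg t f`. -/
def gaussAvg₁ (t : ℝ≥0) (f : ℝ → ℝ) (x : ℝ) : ℝ :=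
  ∫ y, f (x + y) * (y / t) ∂gaussianReal 0 t

/-- Second derivative of `gaussAvg t f`. -/
def gaussAvg₂ (t : ℝ≥0) (f : ℝ → ℝ) (x : ℝ) : ℝ :=
  ∫ y, f (x + y) * (y ^ 2 / t ^ 2 - 1 / t) ∂gaussianReal 0 t

/-- The exponential moments of a Gaussian with density `f`. -/
def tiltMoment (t : ℝ≥0) (f : ℝ → ℝ) (k : ℕ) (s : ℝ) : ℝ :=
  ∫ y, f y * (y ^ k * Real.exp (s * y)) ∂gaussianReal 0 t

theorem integrable_tiltMoment (t : ℝ≥0) {f : ℝ → ℝ} (hf : Continuous f) {B : ℝ}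
    (hB : ∀ x, |f x| ≤ B) (k : ℕ) (s : ℝ) :
    Integrable (fun y => f y * (y ^ k * Real.exp (s * y))) (gaussianReal 0 t) := by
  have h := integrable_pow_mul_exp_of_mem_interior_integrableExpSet (X := id)
    (μ := gaussianReal 0 t) (v := s) (by simp) k
  exact h.bdd_mul (c := B) hf.aestronglyMeasurable (Eventually.of_forall hB)

theorem hasDerivAt_tiltMoment (t : ℝ≥0) {f : ℝ → ℝ} (hf : Continuous f) {B : ℝ}
    (h0 : ∀ x, 0 ≤ f x) (hB : ∀ x, |f x| ≤ B) (k : ℕ) (s : ℝ) :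
    HasDerivAt (tiltMoment t f k) (tiltMoment t f (k + 1) s) s := by
  set ν := (gaussianReal 0 t).withDensity fun y => ENNReal.ofReal (f y) with hν
  have hm : Measurable fun y => ENNReal.ofReal (f y) := hf.measurable.ennreal_ofReal
  have hlt : ∀ᵐ y ∂gaussianReal 0 t, ENNReal.ofReal (f y) < ∞ :=
    Eventually.of_forall fun _ => ENNReal.ofReal_lt_top
  have hset : integrableExpSet id ν = Set.univ := by
    refine Set.eq_univ_of_forall fun s => ?_
    rw [integrableExpSet, Set.mem_ofPred_eq, hν, integrable_withDensity_iff_integrable_smul' hm hlt]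
    have := integrable_tiltMoment t hf hB 0 s
    simpa [ENNReal.toReal_ofReal, h0] using this
  have hM : ∀ (j : ℕ) (r : ℝ), ∫ y, id y ^ j * Real.exp (r * id y) ∂ν = tiltMoment t f j r := by
    intro j r
    rw [hν, integral_withDensity_eq_integral_toReal_smul hm hlt]
    simp [tiltMoment, ENNReal.toReal_ofReal, h0]
  have := hasDerivAt_integral_pow_mul_exp_real (X := id) (μ := ν) (t := s) (by simp [hset]) k
  simp only [hM] at this
  exact this

theorem gaussAvg_eq_tiltMoment {t : ℝ≥0} (ht : t ≠ 0) {f : ℝ → ℝ} (x : ℝ) :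
    gaussAvg t f x = Real.exp (-x ^ 2 / (2 * t)) * tiltMoment t f 0 (x / t) := by
  rw [gaussAvg, integral_gaussian_comp_add ht, tiltMoment, ← integral_const_mul]
  refine integral_congr_ae (Eventually.of_forall fun y => ?_)
  simp only
  rw [sub_eq_add_neg, Real.exp_add, neg_div, pow_zero]
  ring

theorem gaussAvg₁_eq_tiltMoment {t : ℝ≥0} (ht : t ≠ 0) {f : ℝ → ℝ} (hf : Continuous f) {B : ℝ}
    (hB : ∀ x, |f x| ≤ B) (x : ℝ) :
    gaussAvg₁ t f x = Real.exp (-x ^ 2 / (2 * t)) *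
      (tiltMoment t f 1 (x / t) / t - x / t * tiltMoment t f 0 (x / t)) := by
  have h := integral_gaussian_comp_add ht (fun z => f z * ((z - x) / t)) x
  simp only [add_sub_cancel_left] at h
  rw [gaussAvg₁, h, tiltMoment, tiltMoment, ← integral_div, ← integral_const_mul,
    ← integral_sub ((integrable_tiltMoment t hf hB 1 _).div_const _)
      ((integrable_tiltMoment t hf hB 0 _).const_mul _), ← integral_const_mul]
  refine integral_congr_ae (Eventually.of_forall fun y => ?_)
  simp only
  rw [sub_eq_add_neg (x / t * y), Real.exp_add, neg_div]
  ring

theorem gaussAvg₂_eq_tiltMoment {t : ℝ≥0} (ht : t ≠ 0) {f : ℝ → ℝ} (hf : Continuous f) {B : ℝ}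
    (hB : ∀ x, |f x| ≤ B) (x : ℝ) :
    gaussAvg₂ t f x = Real.exp (-x ^ 2 / (2 * t)) *
      (tiltMoment t f 2 (x / t) / t ^ 2 - 2 * x / t ^ 2 * tiltMoment t f 1 (x / t) +
        (x ^ 2 / t ^ 2 - 1 / t) * tiltMoment t f 0 (x / t)) := by
  have h := integral_gaussian_comp_add ht (fun z => f z * ((z - x) ^ 2 / t ^ 2 - 1 / t)) x
  simp only [add_sub_cancel_left] at h
  have i0 := integrable_tiltMoment t hf hB 0 (x / t)
  have i1 := integrable_tiltMoment t hf hB 1 (x / t)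
  have i2 := integrable_tiltMoment t hf hB 2 (x / t)
  have i12 : Integrable (fun y => f y * (y ^ 2 * Real.exp (x / t * y)) / t ^ 2 -
      2 * x / t ^ 2 * (f y * (y ^ 1 * Real.exp (x / t * y)))) (gaussianReal 0 t) :=
    (i2.div_const _).sub (i1.const_mul _)
  rw [gaussAvg₂, h, tiltMoment, tiltMoment, tiltMoment, ← integral_div, ← integral_const_mul,
    ← integral_const_mul, ← integral_sub (i2.div_const _) (i1.const_mul _),
    ← integral_add i12 (i0.const_mul _), ← integral_const_mul]
  refine integral_congr_ae (Eventually.of_forall fun y => ?_)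
  simp only
  rw [sub_eq_add_neg (x / t * y), Real.exp_add, neg_div]
  ring

theorem hasDerivAt_gaussAvg {t : ℝ≥0} (ht : t ≠ 0) {f : ℝ → ℝ} (hf : Continuous f) {B : ℝ}
    (h0 : ∀ x, 0 ≤ f x) (hB : ∀ x, |f x| ≤ B) (x : ℝ) :
    HasDerivAt (gaussAvg t f) (gaussAvg₁ t f x) x := by
  have ht' : (t : ℝ) ≠ 0 := by exact_mod_cast ht
  have hE : HasDerivAt (fun x : ℝ => Real.exp (-x ^ 2 / (2 * t)))
      (Real.exp (-x ^ 2 / (2 * t)) * (-(2 * x) / (2 * t))) x := by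
    have := ((hasDerivAt_pow 2 x).neg.div_const (2 * (t : ℝ))).exp
    simpa using this
  have hd : HasDerivAt (fun x : ℝ => x / (t : ℝ)) (1 / t) x := (hasDerivAt_id x).div_const _
  have h := hE.mul ((hasDerivAt_tiltMoment t hf h0 hB 0 (x / t)).comp x hd)
  rw [funext fun x => gaussAvg_eq_tiltMoment (f := f) ht x, gaussAvg₁_eq_tiltMoment ht hf hB]
  refine h.congr_deriv ?_
  simp only [Function.comp, zero_add]
  field_simp
  ring

theorem hasDerivAt_gaussAvg₁ {t : ℝ≥0} (ht : t ≠ 0) {f : ℝ → ℝ} (hf : Continuous f) {B : ℝ}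
    (h0 : ∀ x, 0 ≤ f x) (hB : ∀ x, |f x| ≤ B) (x : ℝ) :
    HasDerivAt (gaussAvg₁ t f) (gaussAvg₂ t f x) x := by
  have ht' : (t : ℝ) ≠ 0 := by exact_mod_cast ht
  have hE : HasDerivAt (fun x : ℝ => Real.exp (-x ^ 2 / (2 * t)))
      (Real.exp (-x ^ 2 / (2 * t)) * (-(2 * x) / (2 * t))) x := by
    have := ((hasDerivAt_pow 2 x).neg.div_const (2 * (t : ℝ))).exp
    simpa using this
  have hd : HasDerivAt (fun x : ℝ => x / (t : ℝ)) (1 / t) x := (hasDerivAt_id x).div_const _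
  have h1 := ((hasDerivAt_tiltMoment t hf h0 hB 1 (x / t)).comp x hd).div_const (t : ℝ)
  have h2 := hd.mul ((hasDerivAt_tiltMoment t hf h0 hB 0 (x / t)).comp x hd)
  have h := hE.mul (h1.sub h2)
  rw [funext fun x => gaussAvg₁_eq_tiltMoment (f := f) ht hf hB x,
    gaussAvg₂_eq_tiltMoment ht hf hB]
  refine h.congr_deriv ?_
  simp only [Function.comp, zero_add, Pi.sub_apply, Pi.mul_apply, one_add_one_eq_two]
  field_simp
  ring

theorem integrable_abs_pow_gaussian (t : ℝ≥0) (k : ℕ) :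
    Integrable (fun y : ℝ => |y| ^ k) (gaussianReal 0 t) := by
  have h := integrable_tiltMoment t (f := fun _ => 1) continuous_const (B := 1) (by simp) k 0
  simpa using h.abs

theorem integrable_pow_gaussian (t : ℝ≥0) (k : ℕ) :
    Integrable (fun y : ℝ => y ^ k) (gaussianReal 0 t) := by
  have h := integrable_tiltMoment t (f := fun _ => 1) continuous_const (B := 1) (by simp) k 0
  simpa using h

theorem integral_sq_gaussian (t : ℝ≥0) : ∫ y, y ^ 2 ∂gaussianReal 0 t = t := by
  have h := variance_fun_id_gaussianReal (μ := 0) (v := t)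
  rw [variance_eq_integral (by fun_prop), integral_id_gaussianReal] at h
  simpa using h

theorem abs_gaussAvg₂_sub_le {t : ℝ≥0} (ht : t ≠ 0) {f : ℝ → ℝ} (hf : Continuous f) {B L : ℝ}
    (hB : ∀ x, |f x| ≤ B) (hL : ∀ x y, |f x - f y| ≤ L * |x - y|) (x y : ℝ) :
    |gaussAvg₂ t f x - gaussAvg₂ t f y| ≤ 2 * L / t * |x - y| := by
  have ht' : (0 : ℝ) < t := by exact_mod_cast pos_iff_ne_zero.2 ht
  have hL0 : 0 ≤ L := by simpa using (abs_nonneg _).trans (hL 1 0)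
  have iq : Integrable (fun z : ℝ => z ^ 2 / (t : ℝ) ^ 2 - 1 / t) (gaussianReal 0 t) :=
    ((integrable_pow_gaussian t 2).div_const _).sub (integrable_const _)
  have ia : Integrable (fun z : ℝ => L * |x - y| * (z ^ 2 / (t : ℝ) ^ 2 + 1 / t))
      (gaussianReal 0 t) :=
    (((integrable_pow_gaussian t 2).div_const _).add (integrable_const _)).const_mul _
  have ii : ∀ x, Integrable (fun z : ℝ => f (x + z) * (z ^ 2 / (t : ℝ) ^ 2 - 1 / t))
      (gaussianReal 0 t) := fun x =>
    iq.bdd_mul (c := B) (by fun_prop) (Eventually.of_forall fun _ => hB _)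
  rw [gaussAvg₂, gaussAvg₂, ← integral_sub (ii x) (ii y)]
  have h := norm_integral_le_of_norm_le ia (f := fun z => f (x + z) * (z ^ 2 / (t : ℝ) ^ 2 - 1 / t) -
      f (y + z) * (z ^ 2 / (t : ℝ) ^ 2 - 1 / t)) (Eventually.of_forall fun z => by
    rw [← sub_mul, norm_mul]
    refine mul_le_mul ((hL _ _).trans_eq (by ring_nf)) ?_ (norm_nonneg _) (by positivity)
    refine (norm_sub_le _ _).trans_eq ?_
    rw [Real.norm_of_nonneg (by positivity), Real.norm_of_nonneg (by positivity)])
  refine h.trans_eq ?_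
  rw [integral_const_mul, integral_add ((integrable_pow_gaussian t 2).div_const _)
    (integrable_const _), integral_div, integral_sq_gaussian]
  simp
  field_simp
  ring

end Gaussian

section Lindeberg

open ProbabilityTheory

theorem abs_taylor_two_le {h h₁ h₂ : ℝ → ℝ} (hd : ∀ x, HasDerivAt h (h₁ x) x)
    (hd₁ : ∀ x, HasDerivAt h₁ (h₂ x) x) {K : ℝ} (hK : ∀ x y, |h₂ x - h₂ y| ≤ K * |x - y|)
    (x v : ℝ) : |h (x + v) - h x - v * h₁ x - v ^ 2 / 2 * h₂ x| ≤ K * |v| ^ 3 := by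
  have hK0 : 0 ≤ K := by simpa using (abs_nonneg _).trans (hK 1 0)
  have mem : ∀ w ∈ Set.uIcc 0 v, |w| ≤ |v| := fun w hw => by
    simpa using Set.abs_sub_left_of_mem_uIcc hw
  have r1 : ∀ w ∈ Set.uIcc 0 v, |h₁ (x + w) - h₁ x - w * h₂ x| ≤ K * |v| ^ 2 := by
    intro w hw
    have := (convex_uIcc (0 : ℝ) v).norm_image_sub_le_of_norm_hasDerivWithin_le
      (f := fun w => h₁ (x + w) - w * h₂ x) (f' := fun w => h₂ (x + w) - h₂ x) (C := K * |v|)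
      (x := 0) (y := w)
      (fun w _ => by
        have := ((hd₁ (x + w)).comp_const_add x w).fun_sub
          ((hasDerivAt_id' w).mul_const (h₂ x))
        exact (this.congr_deriv (by ring)).hasDerivWithinAt)
      (fun w hw => by
        refine (hK _ _).trans ?_
        simpa using mul_le_mul_of_nonneg_left (mem w hw) hK0) Set.left_mem_uIcc hw
    simp only [add_zero, zero_mul, sub_zero, Real.norm_eq_abs] at this
    calc |h₁ (x + w) - h₁ x - w * h₂ x| = |h₁ (x + w) - w * h₂ x - h₁ x| := by ring_nf
      _ ≤ _ := this
      _ ≤ K * |v| * |v| := mul_le_mul_of_nonneg_left (mem w hw) (by positivity)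
      _ = _ := by ring
  have := (convex_uIcc (0 : ℝ) v).norm_image_sub_le_of_norm_hasDerivWithin_le
      (f := fun w => h (x + w) - w * h₁ x - w ^ 2 / 2 * h₂ x)
      (f' := fun w => h₁ (x + w) - h₁ x - w * h₂ x) (C := K * |v| ^ 2)
      (x := 0) (y := v)
      (fun w _ => by
        have := (((hd (x + w)).comp_const_add x w).fun_sub
          ((hasDerivAt_id' w).mul_const (h₁ x))).fun_sub
          (((hasDerivAt_pow 2 w).div_const 2).mul_const (h₂ x))
        exact (this.congr_deriv (by push_cast; ring)).hasDerivWithinAt)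
      r1 Set.left_mem_uIcc Set.right_mem_uIcc
  simp only [add_zero, zero_mul, sub_zero, Real.norm_eq_abs, ne_eq, OfNat.ofNat_ne_zero,
    not_false_eq_true, zero_pow, zero_div] at this
  calc |h (x + v) - h x - v * h₁ x - v ^ 2 / 2 * h₂ x|
      = |h (x + v) - v * h₁ x - v ^ 2 / 2 * h₂ x - h x| := by ring_nf
    _ ≤ _ := this
    _ = _ := by ring

/-- The variance of the uniform distribution on `[0, 1]`. -/
def unifVar : ℝ≥0 := 1 / 12

theorem abs_unifAvg_sub_gaussAvg_le {h h₁ h₂ : ℝ → ℝ} (hd : ∀ x, HasDerivAt h (h₁ x) x)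
    (hd₁ : ∀ x, HasDerivAt h₁ (h₂ x) x) {K B : ℝ} (hK : ∀ x y, |h₂ x - h₂ y| ≤ K * |x - y|)
    (hB : ∀ x, |h x| ≤ B) (x : ℝ) :
    |unifAvg h x - gaussAvg unifVar h (x + 1 / 2)| ≤
      K * (1 + ∫ y, |y| ^ 3 ∂gaussianReal 0 unifVar) := by
  have hK0 : 0 ≤ K := by simpa using (abs_nonneg _).trans (hK 1 0)
  have hc : Continuous h := continuous_iff_continuousAt.2 fun x => (hd x).continuousAt
  set z := x + 1 / 2 with hz
  have hu : |unifAvg h x - (h z + h₂ z / 24)| ≤ K := by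
    have e : unifAvg h x - (h z + h₂ z / 24) =
        ∫ v in (0 : ℝ)..1, (h (z + (v - 1 / 2)) - h z - (v - 1 / 2) * h₁ z -
          (v - 1 / 2) ^ 2 / 2 * h₂ z) := by
      have i1 : IntervalIntegrable (fun v => h (x + v)) volume 0 1 :=
        Continuous.intervalIntegrable (by fun_prop) _ _
      have e1 : ∀ v : ℝ, (h (z + (v - 1 / 2)) - h z - (v - 1 / 2) * h₁ z -
          (v - 1 / 2) ^ 2 / 2 * h₂ z) = h (x + v) - (h z + (v - 1 / 2) * h₁ z +
          (v - 1 / 2) ^ 2 / 2 * h₂ z) := fun v => by rw [hz]; ring_nf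
      simp only [e1]
      rw [intervalIntegral.integral_sub i1 (Continuous.intervalIntegrable (by fun_prop) _ _),
        unifAvg]
      congr 1
      have : ∀ v : ℝ, h z + (v - 1 / 2) * h₁ z + (v - 1 / 2) ^ 2 / 2 * h₂ z =
        (h z - h₁ z / 2 + h₂ z / 8) + v * (h₁ z - h₂ z / 2) + v ^ 2 * (h₂ z / 2) :=
        fun v => by ring
      simp only [this]
      rw [intervalIntegral.integral_add (Continuous.intervalIntegrable (by fun_prop) _ _)
        (Continuous.intervalIntegrable (by fun_prop) _ _),
        intervalIntegral.integral_add (Continuous.intervalIntegrable (by fun_prop) _ _)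
        (Continuous.intervalIntegrable (by fun_prop) _ _),
        intervalIntegral.integral_mul_const, intervalIntegral.integral_mul_const, integral_id,
        integral_pow, intervalIntegral.integral_const]
      norm_num
      ring
    rw [e]
    have := intervalIntegral.norm_integral_le_of_norm_le_const (a := (0 : ℝ)) (b := 1) (C := K)
      (f := fun v => h (z + (v - 1 / 2)) - h z - (v - 1 / 2) * h₁ z -
          (v - 1 / 2) ^ 2 / 2 * h₂ z) fun v hv => by
        refine (abs_taylor_two_le hd hd₁ hK z (v - 1 / 2)).trans ?_
        rw [Set.uIoc_of_le zero_le_one] at hv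
        have : |v - 1 / 2| ≤ 1 := by rw [abs_le]; constructor <;> linarith [hv.1, hv.2]
        exact mul_le_of_le_one_right hK0 (pow_le_one₀ (abs_nonneg _) this)
    simpa using this
  have hg : |gaussAvg unifVar h z - (h z + h₂ z / 24)| ≤
      K * ∫ y, |y| ^ 3 ∂gaussianReal 0 unifVar := by
    have i1 := integrable_gaussian_comp_add unifVar hc hB z
    have j1 : Integrable (fun y : ℝ => y) (gaussianReal 0 unifVar) := by
      simpa using integrable_pow_gaussian unifVar 1
    have j2 := integrable_pow_gaussian unifVar 2
    have i2 : Integrable (fun v => h (z + v) - h z) (gaussianReal 0 unifVar) :=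
      i1.sub (integrable_const _)
    have i3 : Integrable (fun v => h (z + v) - h z - v * h₁ z) (gaussianReal 0 unifVar) :=
      i2.sub (j1.mul_const _)
    have e : gaussAvg unifVar h z - (h z + h₂ z / 24) =
        ∫ v, (h (z + v) - h z - v * h₁ z - v ^ 2 / 2 * h₂ z) ∂gaussianReal 0 unifVar := by
      rw [integral_sub i3 ((j2.div_const _).mul_const _), integral_sub i2 (j1.mul_const _),
        integral_sub i1 (integrable_const _), integral_mul_const, integral_mul_const,
        integral_div, integral_sq_gaussian, integral_id_gaussianReal]
      simp [gaussAvg, unifVar]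
      ring
    rw [e, ← integral_const_mul]
    exact norm_integral_le_of_norm_le
      (f := fun v => h (z + v) - h z - v * h₁ z - v ^ 2 / 2 * h₂ z) ((integrable_abs_pow_gaussian unifVar 3).const_mul K)
      (Eventually.of_forall fun v => abs_taylor_two_le hd hd₁ hK z v)
  rw [abs_le] at *
  constructor <;> linarith [hu.1, hu.2, hg.1, hg.2]

/-- The constant in the comparison of iterated uniform averages with Gaussian averages. -/
def cltConst : ℝ :=
  24 * (1 + ∫ y, |y| ^ 3 ∂gaussianReal 0 unifVar) + (1 + ∫ y, |y| ∂gaussianReal 0 unifVar)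

theorem cltConst_pos : 0 < cltConst := by
  have h3 : 0 ≤ ∫ y, |y| ^ 3 ∂gaussianReal 0 unifVar := integral_nonneg fun y => by positivity
  have h1 : 0 ≤ ∫ y, |y| ∂gaussianReal 0 unifVar := integral_nonneg fun y => by positivity
  unfold cltConst
  linarith

theorem abs_iterate_unifAvg_sub_gaussAvg_le {f : ℝ → ℝ} {L B : ℝ} (h0 : ∀ x, 0 ≤ f x)
    (hB : ∀ x, |f x| ≤ B) (hL : ∀ x y, |f x - f y| ≤ L * |x - y|) (n : ℕ) (x : ℝ) :
    |unifAvg^[n + 1] f x - gaussAvg ((n + 1 : ℕ) * unifVar) f (x + (n + 1 : ℕ) / 2)| ≤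
      L * cltConst * (1 + harmonic n) := by
  have hL0 : 0 ≤ L := by simpa using (abs_nonneg _).trans (hL 1 0)
  have hf := continuous_of_abs_sub_le hL
  have h3 : 0 ≤ ∫ y, |y| ^ 3 ∂gaussianReal 0 unifVar := integral_nonneg fun y => by positivity
  have h1 : 0 ≤ ∫ y, |y| ∂gaussianReal 0 unifVar := integral_nonneg fun y => by positivity
  induction n generalizing x with
  | zero =>
    simp only [zero_add, Nat.cast_one, one_mul, Function.iterate_one, harmonic_zero, Rat.cast_zero,
      add_zero, mul_one]
    have hu : |unifAvg f x - f (x + 1 / 2)| ≤ L := by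
      have i1 : IntervalIntegrable (fun v => f (x + v)) volume 0 1 :=
        Continuous.intervalIntegrable (by fun_prop) _ _
      have e : unifAvg f x - f (x + 1 / 2) = ∫ v in (0 : ℝ)..1, (f (x + v) - f (x + 1 / 2)) := by
        rw [intervalIntegral.integral_sub i1 (by simp)]; simp [unifAvg]
      rw [e]
      have := intervalIntegral.norm_integral_le_of_norm_le_const (a := (0 : ℝ)) (b := 1) (C := L)
        (f := fun v => f (x + v) - f (x + 1 / 2)) fun v hv => by
          refine (hL _ _).trans ?_
          rw [Set.uIoc_of_le zero_le_one] at hv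
          have : |x + v - (x + 1 / 2)| ≤ 1 := by rw [abs_le]; constructor <;> linarith [hv.1, hv.2]
          exact mul_le_of_le_one_right hL0 this
      simpa using this
    have hg : |gaussAvg unifVar f (x + 1 / 2) - f (x + 1 / 2)| ≤
        L * ∫ y, |y| ∂gaussianReal 0 unifVar := by
      have i1 := integrable_gaussian_comp_add unifVar hf hB (x + 1 / 2)
      have e : gaussAvg unifVar f (x + 1 / 2) - f (x + 1 / 2) =
          ∫ v, (f (x + 1 / 2 + v) - f (x + 1 / 2)) ∂gaussianReal 0 unifVar := by
        rw [integral_sub i1 (integrable_const _)]; simp [gaussAvg]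
      rw [e, ← integral_const_mul]
      have := integrable_abs_pow_gaussian unifVar 1
      simp only [pow_one] at this
      exact norm_integral_le_of_norm_le
        (f := fun v => f (x + 1 / 2 + v) - f (x + 1 / 2)) (this.const_mul L)
        (Eventually.of_forall fun v => (hL _ _).trans_eq (by rw [add_sub_cancel_left]))
    have hc : L * (1 + ∫ y, |y| ∂gaussianReal 0 unifVar) ≤ L * cltConst := by
      refine mul_le_mul_of_nonneg_left ?_ hL0
      unfold cltConst; linarith
    rw [abs_le] at *
    constructor <;> linarith [hu.1, hu.2, hg.1, hg.2]
  | succ n ih =>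
    set t : ℝ≥0 := (n + 1 : ℕ) * unifVar with ht
    set h := gaussAvg t f with hh
    have ht0 : t ≠ 0 := by simp [ht, unifVar]
    have htr : (t : ℝ) = (n + 1) / 12 := by simp [ht, unifVar]; ring
    have hcont : Continuous h :=
      continuous_of_abs_sub_le fun x y => abs_gaussAvg_sub_le t hf hB hL x y
    have hstep := abs_unifAvg_sub_gaussAvg_le (hasDerivAt_gaussAvg ht0 hf h0 hB)
      (hasDerivAt_gaussAvg₁ ht0 hf h0 hB) (abs_gaussAvg₂_sub_le ht0 hf hB hL)
      (abs_gaussAvg_le t hB) (x + (n + 1 : ℕ) / 2)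
    have hcI : ∀ m, Continuous (unifAvg^[m] f) := fun m => by
      induction m with
      | zero => exact hf
      | succ m ih => rw [Function.iterate_succ_apply']; exact continuous_unifAvg ih
    have hfirst : |unifAvg (unifAvg^[n + 1] f) x - unifAvg h (x + (n + 1 : ℕ) / 2)| ≤
        L * cltConst * (1 + harmonic n) := by
      have ih' := ih
      have c1 := hcI (n + 1)
      generalize unifAvg^[n + 1] f = g at ih' c1 ⊢
      unfold unifAvg
      rw [← intervalIntegral.integral_sub (Continuous.intervalIntegrable (by fun_prop) _ _)
        (Continuous.intervalIntegrable (by fun_prop) _ _)]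
      have := intervalIntegral.norm_integral_le_of_norm_le_const (a := (0 : ℝ)) (b := 1)
        (C := L * cltConst * (1 + harmonic n))
        (f := fun v => g (x + v) - h (x + (n + 1 : ℕ) / 2 + v)) fun v hv => by
          refine (ih' (x + v)).trans_eq' ?_
          rw [Real.norm_eq_abs]; ring_nf
      simpa using this
    have hcomb : gaussAvg unifVar (gaussAvg t f) (x + (n + 1 : ℕ) / 2 + 1 / 2) =
        gaussAvg ((n + 1 + 1 : ℕ) * unifVar) f (x + (n + 1 + 1 : ℕ) / 2) := by
      rw [gaussAvg_gaussAvg _ _ hf hB, ht]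
      congr 1
      · push_cast; ring
      · push_cast; ring
    rw [Function.iterate_succ_apply', ← hcomb]
    have hb : 2 * L / t * (1 + ∫ y, |y| ^ 3 ∂gaussianReal 0 unifVar) ≤
        L * cltConst * ((n + 1 : ℝ))⁻¹ := by
      rw [htr, show 2 * L / ((n + 1 : ℝ) / 12) * (1 + ∫ y, |y| ^ 3 ∂gaussianReal 0 unifVar) =
        L * (24 * (1 + ∫ y, |y| ^ 3 ∂gaussianReal 0 unifVar)) * ((n + 1 : ℝ))⁻¹ by
          field_simp; ring]
      gcongr
      unfold cltConst; linarith
    have hH : ((harmonic (n + 1) : ℚ) : ℝ) = harmonic n + ((n + 1 : ℝ))⁻¹ := by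
      rw [harmonic_succ]; push_cast; ring
    rw [hH]
    calc _ ≤ |unifAvg (unifAvg^[n + 1] f) x - unifAvg h (x + (n + 1 : ℕ) / 2)| +
        |unifAvg h (x + (n + 1 : ℕ) / 2) -
          gaussAvg unifVar (gaussAvg t f) (x + (n + 1 : ℕ) / 2 + 1 / 2)| := abs_sub_le _ _ _
      _ ≤ L * cltConst * (1 + harmonic n) + L * cltConst * ((n + 1 : ℝ))⁻¹ :=
        add_le_add hfirst (hstep.trans hb)
      _ = _ := by ring

theorem one_add_harmonic_le (n : ℕ) :
    1 + (harmonic n : ℝ) ≤ 6 * ((n + 1 : ℕ) : ℝ) ^ (1 / 4 : ℝ) := by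
  have h1 : (1 : ℝ) ≤ ((n + 1 : ℕ) : ℝ) := by push_cast; linarith [n.cast_nonneg (α := ℝ)]
  have h2 := harmonic_le_one_add_log n
  have h3 : Real.log n ≤ Real.log (n + 1 : ℕ) := by
    rcases n.eq_zero_or_pos with rfl | hn
    · simp
    · exact Real.log_le_log (by exact_mod_cast hn) (by push_cast; linarith)
  have h4 := Real.log_le_rpow_div (x := ((n + 1 : ℕ) : ℝ)) (by linarith)
    (ε := 1 / 4) (by norm_num)
  have h5 := Real.one_le_rpow h1 (z := 1 / 4) (by norm_num)
  linarith

/-- Quantitative central limit theorem for descents, with Lipschitz test functions. -/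
theorem abs_average_desc_sub_gaussAvg_le {f : ℝ → ℝ} {L B : ℝ} (h0 : ∀ x, 0 ≤ f x)
    (hB : ∀ x, |f x| ≤ B) (hL : ∀ x y, |f x - f y| ≤ L * |x - y|) (n : ℕ) :
    |((n + 1).factorial : ℝ)⁻¹ * ∑ π : Equiv.Perm (Fin (n + 1)), f (desc π - n / 2) -
      ∫ y, f y ∂gaussianReal 0 ((n + 1 : ℕ) * unifVar)| ≤
      L * (1 + 6 * cltConst) * ((n + 1 : ℕ) : ℝ) ^ (1 / 4 : ℝ) := by
  have hL0 : 0 ≤ L := by simpa using (abs_nonneg _).trans (hL 1 0)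
  set Φ : ℝ → ℝ := fun s => f (s - (n + 1 : ℕ) / 2) with hΦ
  have hΦL : ∀ x y, |Φ x - Φ y| ≤ L * |x - y| := fun x y => by
    have := hL (x - (n + 1 : ℕ) / 2) (y - (n + 1 : ℕ) / 2)
    rwa [sub_sub_sub_cancel_right] at this
  have a1 := average_desc_sub_unifAvg_le n hΦL (continuous_of_abs_sub_le hΦL) fun x => hB _
  have a2 := abs_iterate_unifAvg_sub_gaussAvg_le (f := Φ) (fun x => h0 _) (fun x => hB _) hΦL n 0
  have e1 : ∀ π : Equiv.Perm (Fin (n + 1)), Φ (desc π + 1 / 2) = f (desc π - n / 2) := fun π => by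
    rw [hΦ]; simp only; congr 1; push_cast; ring
  have e2 : gaussAvg ((n + 1 : ℕ) * unifVar) Φ (0 + (n + 1 : ℕ) / 2) =
      ∫ y, f y ∂gaussianReal 0 ((n + 1 : ℕ) * unifVar) := by
    simp [gaussAvg, hΦ]
  simp only [e1] at a1
  rw [e2] at a2
  have h5 := Real.one_le_rpow (x := ((n + 1 : ℕ) : ℝ)) (z := 1 / 4)
    (by push_cast; linarith [n.cast_nonneg (α := ℝ)]) (by norm_num)
  have h6 := mul_le_mul_of_nonneg_left (one_add_harmonic_le n) (mul_nonneg hL0 cltConst_pos.le)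
  have h7 := mul_le_mul_of_nonneg_left h5 hL0
  rw [abs_le] at *
  constructor <;> linarith [a1.1, a1.2, a2.1, a2.2]

end Lindeberg

section GaussianEvaluation

open ProbabilityTheory

theorem integral_max_one_sub_exp_gaussian {v : ℝ≥0} (hv : v ≠ 0) {θ : ℝ} (hθ : 0 < θ) :
    ∫ y, max (1 - Real.exp (-θ * y - θ ^ 2 * v / 2)) 0 ∂gaussianReal 0 v =
      (Real.sqrt (2 * Real.pi))⁻¹ *
        ∫ t in (-(θ * Real.sqrt v / 2))..(θ * Real.sqrt v / 2), Real.exp (-t ^ 2 / 2) := by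
  have hv' : (0 : ℝ) < v := by exact_mod_cast pos_iff_ne_zero.2 hv
  set β : ℝ := θ * v / 2 with hβ
  have hβ0 : 0 < β := by positivity
  set G : ℝ → ℝ := (Set.Ioi (-β)).indicator 1 with hG
  have e1 : ∀ y, max (1 - Real.exp (-θ * y - θ ^ 2 * v / 2)) 0 =
      G y - G y * Real.exp (-(θ * v) / v * y - (-(θ * v)) ^ 2 / (2 * v)) := by
    intro y
    have hexp : -(θ * v) / v * y - (-(θ * v)) ^ 2 / (2 * v) = -θ * y - θ ^ 2 * v / 2 := by
      field_simp
    have hfac : -θ * y - θ ^ 2 * v / 2 = -θ * (y + β) := by rw [hβ]; ring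
    rw [hexp, hfac]
    by_cases hy : y ∈ Set.Ioi (-β)
    · have : Real.exp (-θ * (y + β)) ≤ 1 := by
        rw [Real.exp_le_one_iff]
        have : -β < y := hy
        nlinarith
      rw [hG, Set.indicator_of_mem hy, max_eq_left (by linarith)]
      simp
    · have : 1 ≤ Real.exp (-θ * (y + β)) := by
        rw [Real.one_le_exp_iff]
        have : y ≤ -β := not_lt.1 hy
        nlinarith
      rw [hG, Set.indicator_of_notMem hy, max_eq_right (by linarith)]
      simp
  have i1 : Integrable G (gaussianReal 0 v) :=
    (integrable_const (1 : ℝ)).indicator measurableSet_Ioi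
  have i2 : Integrable (fun y => G y * Real.exp (-(θ * v) / v * y - (-(θ * v)) ^ 2 / (2 * v)))
      (gaussianReal 0 v) := by
    have := ((integrable_exp_mul_gaussianReal (μ := 0) (v := v) (-(θ * v) / v)).mul_const
      (Real.exp (-((-(θ * v)) ^ 2 / (2 * v))))).indicator (measurableSet_Ioi (a := -β))
    refine this.congr (Eventually.of_forall fun y => ?_)
    simp only [hG, Set.indicator_apply, Pi.one_apply, sub_eq_add_neg, Real.exp_add]
    split_ifs <;> simp
  simp only [e1]
  rw [integral_sub i1 i2, ← integral_gaussian_comp_add hv]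
  have e2 : ∀ y, G (-(θ * v) + y) = (Set.Ioi β).indicator 1 y := fun y => by
    have : -(θ * v) + y ∈ Set.Ioi (-β) ↔ y ∈ Set.Ioi β := by
      simp only [Set.mem_Ioi, hβ]; constructor <;> intro h <;> linarith
    simp only [hG, Set.indicator_apply, this, Pi.one_apply]
  simp only [e2]
  rw [hG, integral_indicator_one measurableSet_Ioi, integral_indicator_one measurableSet_Ioi,
    ← Set.Ioc_union_Ioi_eq_Ioi (show -β ≤ β by linarith),
    measureReal_union (Set.Ioc_disjoint_Ioi le_rfl) measurableSet_Ioi, add_sub_cancel_right,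
    measureReal_def, gaussianReal_apply_eq_integral _ hv, ENNReal.toReal_ofReal
      (integral_nonneg fun y => gaussianPDFReal_nonneg _ _ _),
    ← intervalIntegral.integral_of_le (by linarith)]
  have hs : 0 < Real.sqrt v := Real.sqrt_pos.2 hv'
  have hss : Real.sqrt v * Real.sqrt v = v := Real.mul_self_sqrt hv'.le
  have hb : θ * Real.sqrt v / 2 = β / Real.sqrt v := by
    rw [eq_div_iff hs.ne', hβ]; linear_combination θ / 2 * hss
  rw [hb, ← neg_div (Real.sqrt v) β]
  have hsub := intervalIntegral.integral_comp_div (a := -β) (b := β)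
    (fun t => Real.exp (-t ^ 2 / 2)) hs.ne'
  rw [eq_div_of_mul_eq hs.ne' ((mul_comm _ _).trans hsub.symm), ← mul_div_assoc, ← intervalIntegral.integral_const_mul,
    ← intervalIntegral.integral_div]
  refine intervalIntegral.integral_congr fun y _ => ?_
  simp only [gaussianPDFReal, sub_zero]
  rw [Real.sqrt_mul (by positivity), mul_inv, div_pow, Real.sq_sqrt hv'.le]
  field_simp

end GaussianEvaluation

section TotalVariation

/-- The likelihood ratio between the `m`-shuffle and the uniform distribution at a permutation
of `{0, …, n}` whose inverse has `d` descents. -/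
def ratio (n m d : ℕ) : ℝ := ((n + m - d).descFactorial (n + 1) : ℝ) / (m : ℝ) ^ (n + 1)

theorem Qs_succ (n m : ℕ) (σ : Equiv.Perm (Fin (n + 1))) :
    Qs (n + 1) m σ = ((n + 1).factorial : ℝ)⁻¹ * ratio n m (desc ⇑(σ⁻¹)) := by
  have h := Nat.descFactorial_eq_factorial_mul_choose (n + m - desc ⇑(σ⁻¹)) (n + 1)
  have hf : ((n + 1).factorial : ℝ) ≠ 0 := by exact_mod_cast (n + 1).factorial_ne_zero
  rw [Qs, ratio, rSeq_eq_desc, show n + 1 + m - (1 + desc ⇑(σ⁻¹)) = n + m - desc ⇑(σ⁻¹) by omega, h,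
    Nat.cast_mul]
  field_simp

theorem tv_Qs_Us (n m : ℕ) (hm : 1 ≤ m) :
    tv (n + 1) (Qs (n + 1) m) (Us (n + 1)) =
      ((n + 1).factorial : ℝ)⁻¹ *
        ∑ π : Equiv.Perm (Fin (n + 1)), max (1 - ratio n m (desc π)) 0 := by
  have hU : ∑ σ : Equiv.Perm (Fin (n + 1)), Us (n + 1) σ = 1 := by
    have hf : ((n + 1).factorial : ℝ) ≠ 0 := by exact_mod_cast (n + 1).factorial_ne_zero
    simp only [Us, Finset.sum_const, Finset.card_univ, Fintype.card_perm, Fintype.card_fin,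
      nsmul_eq_mul]
    field_simp
  have key : ∀ σ : Equiv.Perm (Fin (n + 1)), |Qs (n + 1) m σ - Us (n + 1) σ| =
      2 * (((n + 1).factorial : ℝ)⁻¹ * max (1 - ratio n m (desc ⇑(σ⁻¹))) 0) +
        (Qs (n + 1) m σ - Us (n + 1) σ) := fun σ => by
    have hf : (0 : ℝ) < ((n + 1).factorial : ℝ)⁻¹ := by positivity
    rw [Qs_succ, Us]
    rw [show ((n + 1).factorial : ℝ)⁻¹ * ratio n m (desc ⇑(σ⁻¹)) - ((n + 1).factorial : ℝ)⁻¹ =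
      ((n + 1).factorial : ℝ)⁻¹ * (ratio n m (desc ⇑(σ⁻¹)) - 1) by ring, abs_mul, abs_of_pos hf]
    rcases le_total (ratio n m (desc ⇑(σ⁻¹))) 1 with h | h
    · rw [max_eq_left (by linarith), abs_of_nonpos (by linarith)]; ring
    · rw [max_eq_right (by linarith), abs_of_nonneg (by linarith)]; ring
  have hinv : ∑ σ : Equiv.Perm (Fin (n + 1)), max (1 - ratio n m (desc ⇑(σ⁻¹))) 0 =
      ∑ π : Equiv.Perm (Fin (n + 1)), max (1 - ratio n m (desc π)) 0 :=
    Equiv.sum_comp (Equiv.inv (Equiv.Perm (Fin (n + 1)))) fun π => max (1 - ratio n m (desc ⇑π)) 0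
  rw [tv, Finset.sum_congr rfl fun σ _ => key σ, Finset.sum_add_distrib, Finset.sum_sub_distrib,
    sum_Qs n m hm, hU, ← Finset.mul_sum, ← Finset.mul_sum, hinv]
  ring

theorem abs_log_one_add_sub_le {x : ℝ} (hx : |x| ≤ 1 / 2) :
    |Real.log (1 + x) - (x - x ^ 2 / 2)| ≤ 2 * |x| ^ 3 := by
  have h := Real.abs_log_sub_add_sum_range_le (x := -x) (by rw [abs_neg]; linarith) 2
  simp only [Finset.sum_range_succ, Finset.sum_range_zero, abs_neg, sub_neg_eq_add] at h
  norm_num at h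
  calc |Real.log (1 + x) - (x - x ^ 2 / 2)| = |-x + x ^ 2 / 2 + Real.log (1 + x)| := by
        congr 1; ring
    _ ≤ _ := h
    _ ≤ 2 * |x| ^ 3 := by
      rw [div_le_iff₀ (by linarith)]
      nlinarith [pow_nonneg (abs_nonneg x) 3]

theorem sum_range_shift (n : ℕ) (z : ℝ) :
    ∑ i ∈ Finset.range (n + 1), (z - i) = (n + 1) * (z - n / 2) := by
  induction n with
  | zero => simp
  | succ n ih => rw [Finset.sum_range_succ, ih]; push_cast; ring

theorem sum_range_shift_sq (n : ℕ) (z : ℝ) :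
    ∑ i ∈ Finset.range (n + 1), (z - i) ^ 2 =
      ((n + 1) ^ 3 - (n + 1)) / 12 + (n + 1) * (z - n / 2) ^ 2 := by
  induction n with
  | zero => simp
  | succ n ih => rw [Finset.sum_range_succ, ih]; push_cast; ring

theorem ratio_eq_prod {n m d : ℕ} (hd : d ≤ n) (hm : n + 1 ≤ m) :
    ratio n m d = ∏ i ∈ Finset.range (n + 1), (1 + ((n : ℝ) - d - i) / m) := by
  have hm0 : (m : ℝ) ≠ 0 := by exact_mod_cast (by omega : m ≠ 0)
  rw [ratio, Nat.descFactorial_eq_prod_range, Nat.cast_prod, div_eq_iff (pow_ne_zero _ hm0)]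
  nth_rw 3 [← Finset.card_range (n + 1)]
  rw [← Finset.prod_const, ← Finset.prod_mul_distrib]
  refine Finset.prod_congr rfl fun i hi => ?_
  have := Finset.mem_range.1 hi
  rw [Nat.cast_sub (by omega), Nat.cast_sub (by omega)]
  push_cast
  field_simp
  ring

theorem ratio_pos {n m d : ℕ} (hd : d ≤ n) (hm : n + 1 ≤ m) : 0 < ratio n m d := by
  have hm0 : 0 < m := by omega
  have : 0 < (n + m - d).descFactorial (n + 1) := Nat.descFactorial_pos.2 (by omega)
  unfold ratio
  positivity

theorem abs_log_ratio_sub_le {n m d : ℕ} (hd : d ≤ n) (hm : 2 * (n + 1) ≤ m) {θ : ℝ}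
    (hθ : θ = (n + 1) / m) :
    |Real.log (ratio n m d) - (-θ * (d - n / 2) - θ ^ 2 * ((n + 1) / 12) / 2)| ≤
      θ ^ 2 / (24 * (n + 1)) + θ ^ 2 / 2 * |(d : ℝ) - n / 2| + 2 * (n + 1) * θ ^ 3 := by
  have hm0 : (0 : ℝ) < m := by exact_mod_cast (by omega : 0 < m)
  have hN : (0 : ℝ) < n + 1 := by positivity
  have hm2 : 2 * ((n : ℝ) + 1) ≤ m := by exact_mod_cast hm
  have hdn : (d : ℝ) ≤ n := by exact_mod_cast hd
  have hd0 : (0 : ℝ) ≤ d := d.cast_nonneg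
  have hθ0 : 0 < θ := by rw [hθ]; positivity
  have hθ2 : θ ≤ 1 / 2 := by rw [hθ, div_le_iff₀ hm0]; linarith
  have hx : ∀ i ∈ Finset.range (n + 1), |((n : ℝ) - d - i) / m| ≤ θ := fun i hi => by
    have : (i : ℝ) ≤ n := by exact_mod_cast Nat.lt_succ_iff.1 (Finset.mem_range.1 hi)
    have hi0 : (0 : ℝ) ≤ i := i.cast_nonneg
    rw [abs_div, abs_of_pos hm0, hθ]
    gcongr
    rw [abs_le]; constructor <;> linarith
  have hpos : ∀ i ∈ Finset.range (n + 1), 1 + ((n : ℝ) - d - i) / m ≠ 0 := fun i hi => by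
    have := (abs_le.1 (hx i hi)).1
    linarith
  have h1 : |∑ i ∈ Finset.range (n + 1), (Real.log (1 + ((n : ℝ) - d - i) / m) -
      (((n : ℝ) - d - i) / m - (((n : ℝ) - d - i) / m) ^ 2 / 2))| ≤ 2 * (n + 1) * θ ^ 3 := by
    refine (Finset.abs_sum_le_sum_abs _ _).trans ?_
    calc _ ≤ ∑ i ∈ Finset.range (n + 1), 2 * θ ^ 3 := Finset.sum_le_sum fun i hi =>
          (abs_log_one_add_sub_le ((hx i hi).trans hθ2)).trans (by gcongr; exact hx i hi)
      _ = _ := by simp; ring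
  have h2 : ∑ i ∈ Finset.range (n + 1), (Real.log (1 + ((n : ℝ) - d - i) / m) -
      (((n : ℝ) - d - i) / m - (((n : ℝ) - d - i) / m) ^ 2 / 2)) =
      Real.log (ratio n m d) - (-θ * (d - n / 2) - θ ^ 2 * ((n + 1) / 12) / 2) -
        (θ ^ 2 / (24 * (n + 1)) - θ ^ 2 / 2 * ((d - n / 2) ^ 2 / (n + 1))) := by
    rw [ratio_eq_prod hd (by omega), Real.log_prod hpos, Finset.sum_sub_distrib,
      Finset.sum_sub_distrib, ← Finset.sum_div]
    simp only [div_pow]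
    rw [← Finset.sum_div, ← Finset.sum_div, sum_range_shift, sum_range_shift_sq, hθ]
    field_simp
    ring
  have h3 : ((d : ℝ) - n / 2) ^ 2 / (n + 1) ≤ |(d : ℝ) - n / 2| := by
    rw [div_le_iff₀ hN, ← sq_abs, sq]
    refine mul_le_mul_of_nonneg_left ?_ (abs_nonneg _)
    rw [abs_le]; constructor <;> linarith
  have h4 : θ ^ 2 / 2 * (((d : ℝ) - n / 2) ^ 2 / (n + 1)) ≤ θ ^ 2 / 2 * |(d : ℝ) - n / 2| := by
    gcongr
  have h5 : 0 ≤ θ ^ 2 / 2 * (((d : ℝ) - n / 2) ^ 2 / (n + 1)) := by positivity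
  have h6 : 0 ≤ θ ^ 2 / (24 * ((n : ℝ) + 1)) := by positivity
  rw [h2] at h1
  rw [abs_le] at h1 ⊢
  constructor <;> linarith [h1.1, h1.2]

theorem abs_max_one_sub_exp_sub_le (x y : ℝ) :
    |max (1 - Real.exp x) 0 - max (1 - Real.exp y) 0| ≤ |x - y| := by
  wlog h : x ≤ y generalizing x y
  · rw [abs_sub_comm, abs_sub_comm x]; exact this y x (le_of_not_ge h)
  have hxy := Real.exp_le_exp.2 h
  have h1 : max (1 - Real.exp y) 0 ≤ max (1 - Real.exp x) 0 := by gcongr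
  rw [abs_of_nonneg (by linarith), abs_of_nonpos (by linarith), sub_le_iff_le_add,
    max_le_iff]
  refine ⟨?_, by linarith [le_max_right (1 - Real.exp y) 0]⟩
  rcases le_total y 0 with hy | hy
  · have e1 : Real.exp y ≤ 1 := Real.exp_le_one_iff.2 hy
    have e2 : Real.exp x = Real.exp y * Real.exp (x - y) := by rw [← Real.exp_add]; ring_nf
    have e3 := Real.add_one_le_exp (x - y)
    have : Real.exp y * (x - y + 1) ≤ Real.exp x := by
      rw [e2]; gcongr
    nlinarith [le_max_left (1 - Real.exp y) 0]
  · linarith [le_max_right (1 - Real.exp y) 0, Real.add_one_le_exp x]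

open ProbabilityTheory

theorem integral_abs_gaussian_le {v : ℝ≥0} (hv : v ≠ 0) :
    ∫ y, |y| ∂gaussianReal 0 v ≤ Real.sqrt v := by
  have hs : 0 < Real.sqrt v := Real.sqrt_pos.2 (by exact_mod_cast pos_iff_ne_zero.2 hv)
  have hss : Real.sqrt v * Real.sqrt v = v := Real.mul_self_sqrt v.2
  have i2 := integrable_pow_gaussian v 2
  calc ∫ y, |y| ∂gaussianReal 0 v
      ≤ ∫ y, (y ^ 2 / (2 * Real.sqrt v) + Real.sqrt v / 2) ∂gaussianReal 0 v := by
        refine integral_mono (by simpa using integrable_abs_pow_gaussian v 1)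
          ((i2.div_const _).add (integrable_const _)) fun y => ?_
        have : y ^ 2 / (2 * Real.sqrt v) + Real.sqrt v / 2 - |y| =
            (|y| - Real.sqrt v) ^ 2 / (2 * Real.sqrt v) := by
          rw [← sq_abs]; field_simp; ring
        have h0 : 0 ≤ (|y| - Real.sqrt v) ^ 2 / (2 * Real.sqrt v) := by positivity
        simp only
        linarith
    _ = Real.sqrt v := by
        rw [integral_add (i2.div_const _) (integrable_const _), integral_div,
          integral_sq_gaussian]
        simp only [integral_const, probReal_univ, one_smul]
        field_simp
        linarith

theorem average_abs_desc_sub_le (n : ℕ) :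
    ((n + 1).factorial : ℝ)⁻¹ * ∑ π : Equiv.Perm (Fin (n + 1)), |(desc π : ℝ) - n / 2| ≤
      (2 + 6 * cltConst) * Real.sqrt (n + 1) := by
  have hv : ((n + 1 : ℕ) : ℝ≥0) * unifVar ≠ 0 := by simp [unifVar]
  have h := abs_average_desc_sub_gaussAvg_le (f := fun x => min |x| (n + 1)) (L := 1)
    (B := n + 1) (fun x => by positivity) (fun x => by
      rw [abs_of_nonneg (by positivity)]; exact min_le_right _ _) (fun x y => by
      rw [one_mul]
      refine (abs_min_sub_min_le_max _ _ _ _).trans ?_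
      simpa using abs_abs_sub_abs_le x y) n
  have e : ∀ π : Equiv.Perm (Fin (n + 1)), min |(desc π : ℝ) - n / 2| (n + 1) =
      |(desc π : ℝ) - n / 2| := fun π => by
    have h1 : (desc π : ℝ) ≤ n := by exact_mod_cast desc_le _
    have h2 : (0 : ℝ) ≤ desc π := Nat.cast_nonneg _
    refine min_eq_left ?_
    rw [abs_le]; constructor <;> linarith [n.cast_nonneg (α := ℝ)]
  simp only [e] at h
  have i1 : Integrable (fun y : ℝ => |y|) (gaussianReal 0 (((n + 1 : ℕ) : ℝ≥0) * unifVar)) := by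
    simpa using integrable_abs_pow_gaussian (((n + 1 : ℕ) : ℝ≥0) * unifVar) 1
  have h2 : ∫ y, min |y| ((n : ℝ) + 1) ∂gaussianReal 0 (((n + 1 : ℕ) : ℝ≥0) * unifVar) ≤
      Real.sqrt (n + 1) := by
    refine (integral_mono (i1.inf (integrable_const _)) i1 fun y => min_le_left _ _).trans
      ((integral_abs_gaussian_le hv).trans (Real.sqrt_le_sqrt ?_))
    simp [unifVar]
    linarith [n.cast_nonneg (α := ℝ)]
  have h3 : ((n + 1 : ℕ) : ℝ) ^ (1 / 4 : ℝ) ≤ Real.sqrt (n + 1) := by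
    rw [Real.sqrt_eq_rpow]
    push_cast
    exact Real.rpow_le_rpow_of_exponent_le (by linarith [n.cast_nonneg (α := ℝ)]) (by norm_num)
  have h4 := mul_le_mul_of_nonneg_left h3
    (show 0 ≤ 1 * (1 + 6 * cltConst) by linarith [cltConst_pos])
  linarith [(abs_le.1 h).2]

end TotalVariation

section Asymptotics

open ProbabilityTheory

theorem abs_tv_sub_integral_le {n m : ℕ} (hm : 2 * (n + 1) ≤ m) {θ : ℝ}
    (hθ : θ = (n + 1) / m) :
    |tv (n + 1) (Qs (n + 1) m) (Us (n + 1)) -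
      ∫ y, max (1 - Real.exp (-θ * y - θ ^ 2 * ((n + 1) / 12) / 2)) 0
        ∂gaussianReal 0 ((n + 1 : ℕ) * unifVar)| ≤
      θ ^ 2 / (24 * (n + 1)) + θ ^ 2 / 2 * ((2 + 6 * cltConst) * Real.sqrt (n + 1)) +
        2 * (n + 1) * θ ^ 3 + θ * (1 + 6 * cltConst) * ((n + 1 : ℕ) : ℝ) ^ (1 / 4 : ℝ) := by
  have hθ0 : 0 ≤ θ := by rw [hθ]; positivity
  set κ : ℝ := θ ^ 2 * ((n + 1) / 12) / 2 with hκ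
  set A : ℝ := ((n + 1).factorial : ℝ)⁻¹ with hA
  have hA0 : 0 < A := by positivity
  have hA1 : A * ∑ _π : Equiv.Perm (Fin (n + 1)), (1 : ℝ) = 1 := by
    simp only [Finset.sum_const, Finset.card_univ, Fintype.card_perm, Fintype.card_fin,
      nsmul_eq_mul, mul_one, hA]
    exact inv_mul_cancel₀ (by positivity)
  have hF : ∀ x, 0 ≤ max (1 - Real.exp x) 0 ∧ max (1 - Real.exp x) 0 ≤ 1 := fun x =>
    ⟨le_max_right _ _, max_le (by linarith [Real.exp_pos x]) zero_le_one⟩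
  have h1 := abs_average_desc_sub_gaussAvg_le
    (f := fun y => max (1 - Real.exp (-θ * y - κ)) 0) (L := θ) (B := 1)
    (fun x => (hF _).1) (fun x => by rw [abs_of_nonneg (hF _).1]; exact (hF _).2)
    (fun x y => by
      refine (abs_max_one_sub_exp_sub_le _ _).trans_eq ?_
      rw [show -θ * x - κ - (-θ * y - κ) = -(θ * (x - y)) by ring, abs_neg, abs_mul,
        abs_of_nonneg hθ0]) n
  have h2 : |tv (n + 1) (Qs (n + 1) m) (Us (n + 1)) -
      A * ∑ π : Equiv.Perm (Fin (n + 1)), max (1 - Real.exp (-θ * (desc π - n / 2) - κ)) 0| ≤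
      θ ^ 2 / (24 * (n + 1)) + θ ^ 2 / 2 * ((2 + 6 * cltConst) * Real.sqrt (n + 1)) +
        2 * (n + 1) * θ ^ 3 := by
    rw [tv_Qs_Us n m (by omega), ← mul_sub, ← Finset.sum_sub_distrib, abs_mul, abs_of_pos hA0]
    calc _ ≤ A * ∑ π : Equiv.Perm (Fin (n + 1)),
          ((θ ^ 2 / (24 * (n + 1)) + 2 * (n + 1) * θ ^ 3) * 1 +
            θ ^ 2 / 2 * |(desc π : ℝ) - n / 2|) := by
          refine mul_le_mul_of_nonneg_left ((Finset.abs_sum_le_sum_abs _ _).trans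
            (Finset.sum_le_sum fun π _ => ?_)) hA0.le
          have hd : desc (π : Fin (n + 1) → Fin (n + 1)) ≤ n := desc_le _
          have h := abs_log_ratio_sub_le hd hm hθ
          have h' := abs_max_one_sub_exp_sub_le (Real.log (ratio n m (desc π)))
            (-θ * (desc π - n / 2) - κ)
          rw [Real.exp_log (ratio_pos hd (by omega))] at h'
          linarith
      _ = (θ ^ 2 / (24 * (n + 1)) + 2 * (n + 1) * θ ^ 3) * (A * ∑ _π, 1) +
            θ ^ 2 / 2 * (A * ∑ π : Equiv.Perm (Fin (n + 1)), |(desc π : ℝ) - n / 2|) := by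
          rw [Finset.sum_add_distrib, ← Finset.mul_sum, ← Finset.mul_sum]; ring
      _ ≤ (θ ^ 2 / (24 * (n + 1)) + 2 * (n + 1) * θ ^ 3) * 1 +
            θ ^ 2 / 2 * ((2 + 6 * cltConst) * Real.sqrt (n + 1)) := by
          rw [hA1]
          have := mul_le_mul_of_nonneg_left (average_abs_desc_sub_le n)
            (show 0 ≤ θ ^ 2 / 2 by positivity)
          linarith
      _ = _ := by ring
  exact (abs_sub_le _ _ _).trans (add_le_add h2 h1)

theorem integral_eq_Psi {n m : ℕ} (hm : 1 ≤ m) {θ : ℝ} (hθ : θ = (n + 1) / m) :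
    ∫ y, max (1 - Real.exp (-θ * y - θ ^ 2 * ((n + 1) / 12) / 2)) 0
        ∂gaussianReal 0 ((n + 1 : ℕ) * unifVar) =
      Psi (((m : ℝ) * ((n + 1 : ℕ) : ℝ) ^ (-(3 / 2) : ℝ))⁻¹) := by
  have hm0 : (0 : ℝ) < m := by exact_mod_cast hm
  have hN : (0 : ℝ) < n + 1 := by positivity
  have hv : ((n + 1 : ℕ) : ℝ≥0) * unifVar ≠ 0 := by simp [unifVar]
  have hvr : ((((n + 1 : ℕ) : ℝ≥0) * unifVar : ℝ≥0) : ℝ) = (n + 1) / 12 := by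
    simp [unifVar]; ring
  have h := integral_max_one_sub_exp_gaussian hv (θ := θ) (by rw [hθ]; positivity)
  rw [hvr] at h
  rw [h, Psi]
  have h3 : Real.sqrt 3 * Real.sqrt 3 = 3 := Real.mul_self_sqrt (by norm_num)
  have hs3 : 0 < Real.sqrt 3 := Real.sqrt_pos.2 (by norm_num)
  have hsN : 0 < Real.sqrt (n + 1) := Real.sqrt_pos.2 hN
  have h12 : Real.sqrt (((n : ℝ) + 1) / 12) = Real.sqrt (n + 1) / (2 * Real.sqrt 3) := by
    rw [Real.sqrt_div hN.le, show (12 : ℝ) = 2 ^ 2 * 3 by norm_num,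
      Real.sqrt_mul (by norm_num), Real.sqrt_sq (by norm_num)]
  have hpow : ((n + 1 : ℕ) : ℝ) ^ (-(3 / 2) : ℝ) = ((n + 1) * Real.sqrt (n + 1))⁻¹ := by
    push_cast
    rw [Real.rpow_neg hN.le, show (3 / 2 : ℝ) = 1 + 1 / 2 by norm_num, Real.rpow_add hN,
      Real.rpow_one, Real.sqrt_eq_rpow]
  have hb : θ * Real.sqrt (((n : ℝ) + 1) / 12) / 2 =
      ((m : ℝ) * ((n + 1 : ℕ) : ℝ) ^ (-(3 / 2) : ℝ))⁻¹ / (4 * Real.sqrt 3) := by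
    rw [h12, hpow, hθ]
    field_simp
    norm_num
  rw [hb]

end Asymptotics

/-- Bayer–Diaconis asymptotics for the total variation distance of an `m`-shuffle. -/
theorem tv_m_shuffle_asymptotics (a : ℝ) (ha : 0 < a) :
    ∃ C : ℝ, 0 < C ∧ ∃ N : ℕ, ∀ n m : ℕ, N ≤ n → 1 ≤ m →
      a < (m : ℝ) * (n : ℝ) ^ (-(3 / 2) : ℝ) →
      |tv n (Qs n m) (Us n) - Psi (((m : ℝ) * (n : ℝ) ^ (-(3 / 2) : ℝ))⁻¹)| ≤
        C * (n : ℝ) ^ (-(1 / 4) : ℝ) := by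
  have hK := cltConst_pos
  set K := 2 + 6 * cltConst with hKdef
  refine ⟨1 / a ^ 2 + K / a ^ 2 + 2 / a ^ 3 + K / a, by positivity,
    ⌈4 / a ^ 2⌉₊ + 1, fun n' m hn hm hc => ?_⟩
  obtain ⟨n, rfl⟩ : ∃ n, n' = n + 1 := ⟨n' - 1, by omega⟩
  have hn' : 4 / a ^ 2 ≤ ((n + 1 : ℕ) : ℝ) := (Nat.le_ceil _).trans (by exact_mod_cast by omega)
  have hN1 : (1 : ℝ) ≤ ((n + 1 : ℕ) : ℝ) := by push_cast; linarith [n.cast_nonneg (α := ℝ)]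
  have hNn : ((n + 1 : ℕ) : ℝ) = n + 1 := by push_cast; ring
  have hm0 : (0 : ℝ) < m := by exact_mod_cast hm
  set q : ℝ := ((n + 1 : ℕ) : ℝ) ^ (1 / 4 : ℝ) with hq
  have hq1 : 1 ≤ q := Real.one_le_rpow hN1 (by norm_num)
  have hq0 : 0 < q := by linarith
  have hq4 : q ^ 4 = ((n + 1 : ℕ) : ℝ) := by
    rw [hq, ← Real.rpow_natCast, ← Real.rpow_mul (by linarith)]; norm_num
  have hq6 : ((n + 1 : ℕ) : ℝ) ^ (-(3 / 2) : ℝ) = (q ^ 6)⁻¹ := by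
    rw [Real.rpow_neg (by linarith), hq, ← Real.rpow_natCast, ← Real.rpow_mul (by linarith)]
    norm_num
  have hqi : ((n + 1 : ℕ) : ℝ) ^ (-(1 / 4) : ℝ) = q⁻¹ := Real.rpow_neg (by linarith) _
  have hsq : Real.sqrt (n + 1) = q ^ 2 := by
    rw [← hNn, ← hq4, show q ^ 4 = (q ^ 2) ^ 2 by ring, Real.sqrt_sq (by positivity)]
  have hmq : a * q ^ 6 < m := by
    rw [hq6] at hc
    exact (lt_mul_inv_iff₀ (by positivity)).1 hc
  have haq : 2 ≤ a * q ^ 2 := by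
    rw [div_le_iff₀ (by positivity), ← hq4] at hn'
    exact abs_le_of_sq_le_sq' (by nlinarith) (by positivity) |>.2
  have hm2 : 2 * (n + 1) ≤ m := by
    have : (2 * (n + 1 : ℕ) : ℝ) ≤ m := by
      rw [← hq4]; nlinarith [pow_pos hq0 4]
    exact_mod_cast this
  obtain ⟨θ, hθ⟩ : ∃ θ : ℝ, θ = (n + 1) / m := ⟨_, rfl⟩
  have hθ0 : 0 ≤ θ := by rw [hθ]; positivity
  have hθq : θ ≤ 1 / (a * q ^ 2) := by
    rw [hθ, ← hNn, ← hq4, div_le_div_iff₀ hm0 (by positivity)]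
    nlinarith
  have h := abs_tv_sub_integral_le hm2 hθ
  rw [integral_eq_Psi hm hθ] at h
  refine h.trans ?_
  rw [hqi, hsq, ← hq, ← hNn, ← hq4]
  have hθ2 : θ ^ 2 ≤ 1 / (a ^ 2 * q ^ 4) := by
    calc θ ^ 2 ≤ (1 / (a * q ^ 2)) ^ 2 := by gcongr
      _ = _ := by field_simp
  have hθ3 : θ ^ 3 ≤ 1 / (a ^ 3 * q ^ 6) := by
    calc θ ^ 3 ≤ (1 / (a * q ^ 2)) ^ 3 := by gcongr
      _ = _ := by field_simp
  have t1 : θ ^ 2 / (24 * q ^ 4) ≤ 1 / a ^ 2 * q⁻¹ := by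
    calc θ ^ 2 / (24 * q ^ 4) ≤ 1 / (a ^ 2 * q ^ 4) / 1 := by
          gcongr
          linarith [one_le_pow₀ hq1 (n := 4)]
      _ = 1 / a ^ 2 * (q ^ 4)⁻¹ := by field_simp
      _ ≤ _ := by gcongr; exact le_self_pow₀ hq1 (by norm_num)
  have t2 : θ ^ 2 / 2 * (K * q ^ 2) ≤ K / a ^ 2 * q⁻¹ := by
    calc θ ^ 2 / 2 * (K * q ^ 2) ≤ θ ^ 2 * (K * q ^ 2) := by
          gcongr; linarith [sq_nonneg θ]
      _ ≤ 1 / (a ^ 2 * q ^ 4) * (K * q ^ 2) := by gcongr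
      _ = K / a ^ 2 * (q ^ 2)⁻¹ := by field_simp
      _ ≤ _ := by gcongr; exact le_self_pow₀ hq1 (by norm_num)
  have t3 : 2 * q ^ 4 * θ ^ 3 ≤ 2 / a ^ 3 * q⁻¹ := by
    calc 2 * q ^ 4 * θ ^ 3 ≤ 2 * q ^ 4 * (1 / (a ^ 3 * q ^ 6)) := by gcongr
      _ = 2 / a ^ 3 * (q ^ 2)⁻¹ := by field_simp
      _ ≤ _ := by gcongr; exact le_self_pow₀ hq1 (by norm_num)
  have t4 : θ * (1 + 6 * cltConst) * q ≤ K / a * q⁻¹ := by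
    calc θ * (1 + 6 * cltConst) * q ≤ 1 / (a * q ^ 2) * K * q := by
          gcongr; linarith
      _ = K / a * q⁻¹ := by field_simp
  linarith
end
end

section
/- For all integers n ≥ 1, m ≥ 1 and r ∈ {1,…,n}, if Q_{n,m}(r) ≤ 1/n! then Q_{n,m}(r) ≤ Q_{n,m+1}(r). -/
noncomputable section

/-- `Q_{n,m}(r) = m^{-n} C(n + m - r, n)`. -/
def Qr (n m r : ℕ) : ℝ := ((m : ℝ) ^ n)⁻¹ * (Nat.choose (n + m - r) n : ℝ)

/-- Product form of `Q_{n,m}(r)`, valid when `r ≤ m`. -/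
theorem factorial_mul_Qr {n m r : ℕ} (hm : 1 ≤ m) (hrm : r ≤ m) :
    (n.factorial : ℝ) * Qr n m r =
      ∏ i ∈ Finset.range n, (1 + ((n : ℝ) - r - i) / m) := by
  have hm0 : (m : ℝ) ≠ 0 := by positivity
  have hchoose : (n.factorial : ℝ) * (Nat.choose (n + m - r) n : ℝ) =
      ∏ i ∈ Finset.range n, ((n : ℝ) + m - r - i) := by
    rw [← Nat.cast_mul, ← Nat.descFactorial_eq_factorial_mul_choose,
      Nat.descFactorial_eq_prod_range, Nat.cast_prod]
    refine Finset.prod_congr rfl fun i hi => ?_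
    have hi' := Finset.mem_range.mp hi
    rw [Nat.cast_sub (by omega), Nat.cast_sub (by omega), Nat.cast_add]
  have hfactor : ∀ i ∈ Finset.range n,
      1 + ((n : ℝ) - r - i) / m = ((n : ℝ) + m - r - i) / m := fun i _ => by
    field_simp
    ring
  rw [Finset.prod_congr rfl hfactor, Finset.prod_div_distrib, Finset.prod_const,
    Finset.card_range, ← hchoose, Qr]
  ring

/-- If a product of factors `1 + s i ≥ 0` is at most `1`, then shrinking every `s i` by a common
factor `t ∈ [0, 1]` does not decrease it. -/
theorem prod_one_add_le_prod_one_add_mul {ι : Type*} (S : Finset ι) (s : ι → ℝ) {t : ℝ}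
    (hs : ∀ i ∈ S, -1 ≤ s i) (ht0 : 0 ≤ t) (ht1 : t ≤ 1) (hprod : ∏ i ∈ S, (1 + s i) ≤ 1) :
    ∏ i ∈ S, (1 + s i) ≤ ∏ i ∈ S, (1 + t * s i) := by
  have hnonneg : ∀ i ∈ S, 0 ≤ 1 + s i := fun i hi => by linarith [hs i hi]
  calc ∏ i ∈ S, (1 + s i)
      ≤ (∏ i ∈ S, (1 + s i)) ^ t :=
        Real.self_le_rpow_of_le_one (Finset.prod_nonneg hnonneg) hprod ht1
    _ = ∏ i ∈ S, (1 + s i) ^ t := (Real.finsetProd_rpow S _ hnonneg t).symm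
    _ ≤ ∏ i ∈ S, (1 + t * s i) :=
        Finset.prod_le_prod (fun i hi => Real.rpow_nonneg (hnonneg i hi) t)
          fun i hi => rpow_one_add_le_one_add_mul_self (hs i hi) ht0 ht1

/-- If `Q_{n,m}(r) ≤ 1/n!` then `Q_{n,m}(r) ≤ Q_{n,m+1}(r)`. -/
theorem Qr_mono_of_le_uniform (n m r : ℕ) (hn : 1 ≤ n) (hm : 1 ≤ m)
    (hr : 1 ≤ r) (hrn : r ≤ n) (h : Qr n m r ≤ (n.factorial : ℝ)⁻¹) :
    Qr n m r ≤ Qr n (m + 1) r := by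
  rcases lt_or_ge m r with hmr | hrm
  · have hzero : Qr n m r = 0 := by
      rw [Qr, Nat.choose_eq_zero_of_lt (by omega), Nat.cast_zero, mul_zero]
    rw [hzero, Qr]
    positivity
  have hfac : (0 : ℝ) < n.factorial := by positivity
  have hm0 : (0 : ℝ) < m := by positivity
  have hle : (n.factorial : ℝ) * Qr n m r ≤ 1 := by
    rwa [← le_inv_mul_iff₀ hfac, mul_one]
  refine le_of_mul_le_mul_left ?_ hfac
  rw [factorial_mul_Qr hm hrm] at hle ⊢
  rw [factorial_mul_Qr (by omega) (by omega)]
  have hs : ∀ i ∈ Finset.range n, -1 ≤ ((n : ℝ) - r - i) / m := fun i hi => by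
    have hi' : (i : ℝ) ≤ n := by exact_mod_cast (Finset.mem_range.mp hi).le
    have hrm' : (r : ℝ) ≤ m := by exact_mod_cast hrm
    rw [le_div_iff₀ hm0]
    linarith
  refine (prod_one_add_le_prod_one_add_mul (t := (m : ℝ) / (m + 1)) _ _ hs (by positivity)
    (by rw [div_le_one (by positivity)]; linarith) hle).trans_eq
    (Finset.prod_congr rfl fun i _ => ?_)
  push_cast
  field_simp
end
end

section
/- For all integers n ≥ 1, m ≥ 1 and r ∈ {1,…,n}, letting A_r = {σ ∈ S_n : r(σ) ≥ r} be the set of permutations with at least r rising sequences, one has U_n(A_r) − Q_{n,m}(A_r) ≥ 0. -/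
open Filter MeasureTheory
open scoped BigOperators NNReal ENNReal

noncomputable section

/-- The number of descents of `σ⁻¹` at positions below `i`. -/
def descentsBelow (n : ℕ) (σ : Equiv.Perm (Fin n)) (i : ℕ) : ℕ :=
  ((Finset.range i).filter fun k => invAt n σ (k + 1) < invAt n σ k).card

lemma descentsBelow_succ (n : ℕ) (σ : Equiv.Perm (Fin n)) (i : ℕ) :
    descentsBelow n σ (i + 1) =
      descentsBelow n σ i + if invAt n σ (i + 1) < invAt n σ i then 1 else 0 := by
  unfold descentsBelow
  rw [Finset.range_add_one, Finset.filter_insert]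
  split_ifs <;> simp

lemma descentsBelow_mono (n : ℕ) (σ : Equiv.Perm (Fin n)) : Monotone (descentsBelow n σ) :=
  monotone_nat_of_le_succ fun i => by rw [descentsBelow_succ]; omega

lemma descentsBelow_add_one_le_rSeq (n : ℕ) (σ : Equiv.Perm (Fin n)) {i : ℕ} (hi : i < n) :
    descentsBelow n σ i + 1 ≤ rSeq n σ := by
  have h := descentsBelow_mono n σ (show i ≤ n - 1 by omega)
  have h' : rSeq n σ = 1 + descentsBelow n σ (n - 1) := rfl
  omega

lemma rSeq_le (n : ℕ) (hn : 1 ≤ n) (σ : Equiv.Perm (Fin n)) : rSeq n σ ≤ n := by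
  have h := Finset.card_filter_le (Finset.range (n - 1))
    fun i => invAt n σ (i + 1) < invAt n σ i
  rw [Finset.card_range] at h
  unfold rSeq
  omega

lemma invAt_le_of_descentsBelow_eq (n : ℕ) (σ : Equiv.Perm (Fin n)) {i j : ℕ} (hij : i ≤ j)
    (h : descentsBelow n σ j = descentsBelow n σ i) : invAt n σ i ≤ invAt n σ j := by
  induction j, hij using Nat.le_induction with
  | base => exact le_rfl
  | succ j hij ih =>
    have hmono := descentsBelow_mono n σ hij
    rw [descentsBelow_succ] at h
    split_ifs at h with hd
    · omega
    · exact (ih (by omega)).trans (not_lt.mp hd)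

lemma inv_lt_inv_of_descentsBelow_eq (n : ℕ) (σ : Equiv.Perm (Fin n)) {i j : Fin n}
    (hij : i < j) (h : descentsBelow n σ j = descentsBelow n σ i) : σ⁻¹ i < σ⁻¹ j := by
  have hle := invAt_le_of_descentsBelow_eq n σ (Fin.lt_def.mp hij).le h
  simp only [invAt, i.isLt, j.isLt, dite_true, Fin.eta] at hle
  exact lt_of_le_of_ne hle fun he => hij.ne (σ⁻¹.injective he)

lemma StrictMono.val_add_le_val_add {n N : ℕ} {s : Fin n → Fin N} (hs : StrictMono s)
    {i j : Fin n} (hij : i ≤ j) : (s i : ℕ) + j ≤ s j + i := by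
  obtain ⟨i, hi⟩ := i
  obtain ⟨j, hj⟩ := j
  rw [Fin.mk_le_mk] at hij
  induction j, hij using Nat.le_induction with
  | base => exact le_rfl
  | succ j hij ih =>
    have h1 := ih (by omega)
    have h2 : s ⟨j, by omega⟩ < s ⟨j + 1, hj⟩ := hs (Fin.mk_lt_mk.mpr (Nat.lt_succ_self j))
    rw [Fin.lt_def] at h2
    simp only at h1 ⊢
    omega

lemma StrictMono.le_val {n N : ℕ} {s : Fin n → Fin N} (hs : StrictMono s) (i : Fin n) :
    (i : ℕ) ≤ s i := by
  have h := hs.val_add_le_val_add (i := ⟨0, i.pos⟩) (j := i) (Fin.mk_le_of_le_val (Nat.zero_le _))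
  simp only at h
  omega

lemma StrictMono.val_add_lt {n N : ℕ} {s : Fin n → Fin N} (hs : StrictMono s) (i : Fin n) :
    (s i : ℕ) + n < N + i + 1 := by
  have hi := i.isLt
  have h := hs.val_add_le_val_add (i := i) (j := ⟨n - 1, by omega⟩)
    (by rw [Fin.le_def]; simp only; omega)
  have hN := (s ⟨n - 1, by omega⟩).isLt
  simp only at h
  omega

/-- The assignment of cards to piles obtained from a strictly increasing sequence by
removing one unit for each ascent of `σ⁻¹`. -/
def pileAssignment (n m : ℕ) (hn : 1 ≤ n) (σ : Equiv.Perm (Fin n))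
    (s : Fin n ↪o Fin (n + m - rSeq n σ)) (x : Fin n) : Fin m :=
  ⟨s (σ x) + descentsBelow n σ (σ x) - (σ x : ℕ), by
    have h1 := s.strictMono.val_add_lt (σ x)
    have h2 := s.strictMono.le_val (σ x)
    have h3 := descentsBelow_add_one_le_rSeq n σ (σ x).isLt
    have h4 := rSeq_le n hn σ
    omega⟩

lemma pileAssignment_injective (n m : ℕ) (hn : 1 ≤ n) (σ : Equiv.Perm (Fin n)) :
    Function.Injective (pileAssignment n m hn σ) := by
  intro s t hst
  ext i
  have h := congrArg Fin.val (congrFun hst (σ⁻¹ i))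
  simp only [pileAssignment, Equiv.Perm.inv_def, Equiv.apply_symm_apply] at h
  have hs := s.strictMono.le_val i
  have ht := t.strictMono.le_val i
  omega

lemma sort_pileAssignment (n m : ℕ) (hn : 1 ≤ n) (σ : Equiv.Perm (Fin n))
    (s : Fin n ↪o Fin (n + m - rSeq n σ)) :
    Tuple.sort (pileAssignment n m hn σ s) = σ⁻¹ := by
  symm
  rw [Tuple.eq_sort_iff]
  constructor
  · intro i j hij
    rw [Fin.le_def]
    simp only [Function.comp_apply, pileAssignment, Equiv.Perm.inv_def, Equiv.apply_symm_apply]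
    have h1 := s.strictMono.val_add_le_val_add hij
    have h2 := descentsBelow_mono n σ (Fin.le_def.mp hij)
    omega
  · intro i j hij h
    apply inv_lt_inv_of_descentsBelow_eq n σ hij
    have h' := congrArg Fin.val h
    simp only [pileAssignment, Equiv.Perm.inv_def, Equiv.apply_symm_apply] at h'
    have h1 := s.strictMono.val_add_le_val_add hij.le
    have h2 := descentsBelow_mono n σ (Fin.le_def.mp hij.le)
    have h3 := s.strictMono.le_val i
    have h4 := s.strictMono.le_val j
    omega

lemma choose_le_card_sort_eq_inv (n m : ℕ) (hn : 1 ≤ n) (σ : Equiv.Perm (Fin n)) :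
    Nat.choose (n + m - rSeq n σ) n ≤
      (Finset.univ.filter fun f : Fin n → Fin m => Tuple.sort f = σ⁻¹).card := by
  have hcard : Nat.card (Fin n ↪o Fin (n + m - rSeq n σ)) =
      Nat.choose (n + m - rSeq n σ) n := by
    rw [Nat.card_congr Set.powersetCard.ofFinEmbEquiv, Set.powersetCard.card, Nat.card_fin]
  rw [← hcard, ← Fintype.card_subtype, ← Nat.card_eq_fintype_card]
  exact Nat.card_le_card_of_injective
    (fun s => ⟨pileAssignment n m hn σ s, sort_pileAssignment n m hn σ s⟩)
    fun s t h => pileAssignment_injective n m hn σ (congrArg Subtype.val h)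

lemma sum_choose_rSeq_le (n m : ℕ) (hn : 1 ≤ n) :
    ∑ σ : Equiv.Perm (Fin n), Nat.choose (n + m - rSeq n σ) n ≤ m ^ n := by
  calc ∑ σ : Equiv.Perm (Fin n), Nat.choose (n + m - rSeq n σ) n
      ≤ ∑ σ : Equiv.Perm (Fin n),
          (Finset.univ.filter fun f : Fin n → Fin m => (Tuple.sort f)⁻¹ = σ).card := by
        refine Finset.sum_le_sum fun σ _ => ?_
        simpa only [inv_eq_iff_eq_inv] using choose_le_card_sort_eq_inv n m hn σ
    _ = (Finset.univ : Finset (Fin n → Fin m)).card :=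
        (Finset.card_eq_sum_card_fiberwise fun _ _ => Finset.mem_coe.mpr (Finset.mem_univ _)).symm
    _ = m ^ n := by simp

lemma sum_Qs_le_one (n m : ℕ) (hn : 1 ≤ n) (hm : 1 ≤ m) :
    ∑ σ : Equiv.Perm (Fin n), Qs n m σ ≤ 1 := by
  have hpos : (0 : ℝ) < (m : ℝ) ^ n := pow_pos (Nat.cast_pos.mpr hm) n
  unfold Qs
  rw [← Finset.mul_sum, inv_mul_le_iff₀ hpos, mul_one]
  exact_mod_cast sum_choose_rSeq_le n m hn

lemma sum_Us (n : ℕ) : ∑ σ : Equiv.Perm (Fin n), Us n σ = 1 := by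
  have h : (n.factorial : ℝ) ≠ 0 := Nat.cast_ne_zero.mpr n.factorial_ne_zero
  simp [Us, Fintype.card_perm, h]

/-- On the set of permutations with at least `r` rising sequences, the uniform
distribution dominates the `m`-shuffle distribution. -/
theorem uniform_ge_shuffle_on_upper_set (n m r : ℕ) (hn : 1 ≤ n) (hm : 1 ≤ m)
    (hr : 1 ≤ r) (hrn : r ≤ n) :
    0 ≤ (∑ σ ∈ Finset.univ.filter (fun σ : Equiv.Perm (Fin n) => r ≤ rSeq n σ), Us n σ) -
        ∑ σ ∈ Finset.univ.filter (fun σ : Equiv.Perm (Fin n) => r ≤ rSeq n σ), Qs n m σ := by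
  rw [sub_nonneg]
  set t : ℝ := ((m : ℝ) ^ n)⁻¹ * (Nat.choose (n + m - r) n : ℝ)
  have hinv : (0 : ℝ) ≤ ((m : ℝ) ^ n)⁻¹ := by positivity
  rcases le_total t (n.factorial : ℝ)⁻¹ with h | h
  · refine Finset.sum_le_sum fun σ hσ => le_trans ?_ h
    rw [Finset.mem_filter] at hσ
    refine mul_le_mul_of_nonneg_left (Nat.cast_le.mpr (Nat.choose_le_choose n ?_)) hinv
    omega
  · have hcompl : ∑ σ ∈ Finset.univ.filter (fun σ : Equiv.Perm (Fin n) => ¬ r ≤ rSeq n σ), Us n σ ≤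
        ∑ σ ∈ Finset.univ.filter (fun σ : Equiv.Perm (Fin n) => ¬ r ≤ rSeq n σ), Qs n m σ := by
      refine Finset.sum_le_sum fun σ hσ => le_trans h ?_
      rw [Finset.mem_filter] at hσ
      refine mul_le_mul_of_nonneg_left (Nat.cast_le.mpr (Nat.choose_le_choose n ?_)) hinv
      omega
    have hU := Finset.sum_filter_add_sum_filter_not Finset.univ
      (fun σ : Equiv.Perm (Fin n) => r ≤ rSeq n σ) (Us n)
    have hQ := Finset.sum_filter_add_sum_filter_not Finset.univ
      (fun σ : Equiv.Perm (Fin n) => r ≤ rSeq n σ) (Qs n m)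
    rw [sum_Us] at hU
    have hQ1 := sum_Qs_le_one n m hn hm
    linarith
end
end
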